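/- arXiv:1801.05893 — 10 statements merged into one kernel-verified Lean document; each statement's English description precedes it below -/
import Mathlib

section
/- In the CHSH/Bell game, Charlie chooses x, y ∈ {0,1} uniformly and independently at random and sends x to Alice and y to Bob; without communicating, Alice outputs a bit a (which may depend on x and on shared randomness) and Bob outputs a bit b (which may depend on y and the same shared randomness); they win if a XOR b = x AND y. Then for every classical strategy—i.e., every finite set Λ with a probability distribution μ on Λ and every pair of functions a : {0,1} × Λ → {0,1} and b : {0,1} × Λ → {0,1}—the probability of winning, namely (1/4) ∑_{x,y ∈ {0,1}} ∑_{λ ∈ Λ} μ(λ) · [a(x,λ) XOR b(y,λ) = x AND y], is at most 3/4. -/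
/-- For deterministic responses, at most three of the four question pairs are answered
correctly in the CHSH game. -/
theorem chsh_deterministic_score_le (f g : Bool → Bool) :
    ∑ x : Bool, ∑ y : Bool, (if xor (f x) (g y) = (x && y) then (1 : ℝ) else 0) ≤ 3 := by
  simp only [Fintype.sum_bool]
  cases f true <;> cases f false <;> cases g true <;> cases g false <;> norm_num

/-- **Classical bound for the CHSH/Bell game.**
Charlie chooses `x, y ∈ {0,1}` uniformly and independently; Alice outputs a bit
`a x λ` and Bob a bit `b y λ`, where `λ` is shared randomness drawn from a finite
set `Λ` according to a probability distribution `μ`.  They win when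
`a XOR b = x AND y`.  Every classical strategy wins with probability at most `3/4`. -/
theorem bell_classical_bound (Λ : Type) [Fintype Λ] (μ : Λ → ℝ)
    (hμ0 : ∀ l, 0 ≤ μ l) (hμ1 : ∑ l, μ l = 1)
    (a b : Bool → Λ → Bool) :
    (1 / 4 : ℝ) * ∑ x : Bool, ∑ y : Bool, ∑ l : Λ,
        μ l * (if xor (a x l) (b y l) = (x && y) then (1 : ℝ) else 0) ≤ 3 / 4 := by
  have h : ∑ x : Bool, ∑ y : Bool, ∑ l : Λ,
      μ l * (if xor (a x l) (b y l) = (x && y) then (1 : ℝ) else 0) ≤ 3 := by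
    calc
      _ = ∑ l : Λ, μ l * ∑ x : Bool, ∑ y : Bool,
          (if xor (a x l) (b y l) = (x && y) then (1 : ℝ) else 0) := by
        simp only [Fintype.sum_bool, mul_add, Finset.sum_add_distrib]
      _ ≤ ∑ l : Λ, μ l * 3 := Finset.sum_le_sum fun l _ =>
        mul_le_mul_of_nonneg_left
          (chsh_deterministic_score_le (fun x => a x l) (fun y => b y l)) (hμ0 l)
      _ = 3 := by rw [← Finset.sum_mul, hμ1, one_mul]
  linarith
end

section
/- (Purification.) Every density matrix ρ on ℂ^n is the partial trace of a pure state on ℂ^n ⊗ ℂ^n: there exists a unit vector ψ ∈ ℂ^n ⊗ ℂ^n (i.e., a vector indexed by Fin n × Fin n with ∑ |ψ_{ij}|² = 1) such that the partial trace over the second tensor factor of the rank-one density matrix |ψ⟩⟨ψ| equals ρ. -/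
open Matrix
open scoped ComplexOrder

/-- The pure-state density matrix `|ψ⟩⟨ψ|` attached to a vector `ψ`:
its `(i, j)` entry is `ψ i * conj (ψ j)`. -/
noncomputable def pureStateMatrix {N : Type*} (ψ : N → ℂ) : Matrix N N ℂ :=
  fun i j => ψ i * star (ψ j)

/-- The partial trace over the second tensor factor of a matrix on `ℂ^m ⊗ ℂ^n`. -/
noncomputable def partialTraceSnd {m n : ℕ} (ρ : Matrix (Fin m × Fin n) (Fin m × Fin n) ℂ) :
    Matrix (Fin m) (Fin m) ℂ :=
  fun i i' => ∑ j : Fin n, ρ (i, j) (i', j)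

/-- Viewing a bipartite vector as the matrix `A` of its coefficients, the reduced state of its
pure state is `A * Aᴴ`. -/
theorem partialTraceSnd_pureStateMatrix {m n : ℕ} (A : Matrix (Fin m) (Fin n) ℂ) :
    partialTraceSnd (pureStateMatrix fun p => A p.1 p.2) = A * Aᴴ := by
  ext i j
  simp [partialTraceSnd, pureStateMatrix, mul_apply]

/-- The squared norm of a vector is the trace of its reduced density matrix. -/
theorem trace_partialTraceSnd_pureStateMatrix {m n : ℕ} (ψ : Fin m × Fin n → ℂ) :
    (partialTraceSnd (pureStateMatrix ψ)).trace = ((∑ p, Complex.normSq (ψ p) : ℝ) : ℂ) := by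
  simp [trace, partialTraceSnd, pureStateMatrix, Fintype.sum_prod_type, Complex.mul_conj]

open scoped MatrixOrder in
/-- A positive semidefinite complex matrix factors as `A * Aᴴ`. -/
theorem Matrix.PosSemidef.exists_eq_mul_conjTranspose_self {n : Type*} [Fintype n]
    {ρ : Matrix n n ℂ} (hρ : ρ.PosSemidef) : ∃ A : Matrix n n ℂ, ρ = A * Aᴴ := by
  classical
  obtain ⟨B, hB⟩ := CStarAlgebra.nonneg_iff_eq_star_mul_self.mp hρ.nonneg
  exact ⟨Bᴴ, by rw [conjTranspose_conjTranspose]; exact hB⟩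

/-- **Purification.** Every density matrix `ρ` on `ℂⁿ` is the partial trace (over the
second factor) of a pure state on `ℂⁿ ⊗ ℂⁿ`: there is a unit vector `ψ ∈ ℂⁿ ⊗ ℂⁿ` with
`trace_B |ψ⟩⟨ψ| = ρ`. -/
theorem purification {n : ℕ} (ρ : Matrix (Fin n) (Fin n) ℂ)
    (hρ : ρ.PosSemidef) (hρtr : ρ.trace = 1) :
    ∃ ψ : Fin n × Fin n → ℂ,
      (∑ p, Complex.normSq (ψ p)) = 1 ∧
      partialTraceSnd (pureStateMatrix ψ) = ρ := by
  obtain ⟨A, rfl⟩ := hρ.exists_eq_mul_conjTranspose_self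
  refine ⟨fun p => A p.1 p.2, ?_, partialTraceSnd_pureStateMatrix A⟩
  rw [← partialTraceSnd_pureStateMatrix, trace_partialTraceSnd_pureStateMatrix] at hρtr
  exact_mod_cast hρtr
end

section
/- Let ψ ∈ ℂ^m ⊗ ℂ^n be a unit vector and let ρ = |ψ⟩⟨ψ| be the associated pure state density matrix on ℂ^m ⊗ ℂ^n. Let ρ_A = trace_B(ρ) and ρ_B = trace_A(ρ) be the reduced density matrices obtained by partial trace over the second and first factors respectively. Then H(ρ_A) = H(ρ_B). -/
open Matrix
open scoped ComplexOrder Classical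

/-- The von Neumann entropy `H(ρ) = -∑ᵢ λᵢ log λᵢ` of a (Hermitian) matrix, where the
`λᵢ` are the eigenvalues counted with multiplicity (with the convention `0·log 0 = 0`,
automatic since `Real.log 0 = 0`). -/
noncomputable def vNEntropy {k : Type*} [Fintype k] [DecidableEq k]
    (ρ : Matrix k k ℂ) : ℝ :=
  if h : ρ.IsHermitian then -∑ i, h.eigenvalues i * Real.log (h.eigenvalues i) else 0

/-- Partial trace over the first tensor factor. -/
noncomputable def partialTraceFst {m n : ℕ}
    (ρ : Matrix (Fin m × Fin n) (Fin m × Fin n) ℂ) : Matrix (Fin n) (Fin n) ℂ :=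
  fun j j' => ∑ i : Fin m, ρ (i, j) (i, j')

/-- The von Neumann entropy as a sum over the roots of the characteristic polynomial. -/
theorem vNEntropy_eq_sum_roots_charpoly {k : Type*} [Fintype k] [DecidableEq k]
    {A : Matrix k k ℂ} (hA : A.IsHermitian) :
    vNEntropy A = -(A.charpoly.roots.map fun z => z.re * Real.log z.re).sum := by
  simp [vNEntropy, hA, hA.roots_charpoly_eq_eigenvalues, Multiset.map_map]

/-- Multiplying a nonzero polynomial by a power of `X` does not change the sum over its roots of a
function vanishing at `0`. -/
theorem sum_map_roots_X_pow_mul {R M : Type*} [CommRing R] [IsDomain R] [AddCommMonoid M]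
    {p : Polynomial R} (hp : p ≠ 0) (k : ℕ) {f : R → M} (hf : f 0 = 0) :
    ((Polynomial.X ^ k * p).roots.map f).sum = (p.roots.map f).sum := by
  rw [Polynomial.roots_mul (mul_ne_zero (pow_ne_zero _ Polynomial.X_ne_zero) hp)]
  simp [Multiset.map_nsmul, Multiset.sum_nsmul, hf]

/-- The entropies of `M * Mᴴ` and `Mᴴ * M` agree. -/
theorem vNEntropy_mul_conjTranspose_self {k l : Type*} [Fintype k] [DecidableEq k] [Fintype l]
    [DecidableEq l] (M : Matrix k l ℂ) : vNEntropy (M * Mᴴ) = vNEntropy (Mᴴ * M) := by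
  have hf : (0 : ℂ).re * Real.log (0 : ℂ).re = 0 := by simp
  rw [vNEntropy_eq_sum_roots_charpoly (isHermitian_mul_conjTranspose_self M),
    vNEntropy_eq_sum_roots_charpoly (isHermitian_conjTranspose_mul_self M),
    ← sum_map_roots_X_pow_mul (charpoly_monic _).ne_zero (Fintype.card l) hf,
    charpoly_mul_comm', sum_map_roots_X_pow_mul (charpoly_monic _).ne_zero _ hf]

/-- The entropy of a Hermitian matrix is invariant under transposition. -/
theorem vNEntropy_transpose {k : Type*} [Fintype k] [DecidableEq k]
    {A : Matrix k k ℂ} (hA : A.IsHermitian) : vNEntropy Aᵀ = vNEntropy A := by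
  rw [vNEntropy_eq_sum_roots_charpoly hA, vNEntropy_eq_sum_roots_charpoly hA.transpose,
    charpoly_transpose]

/-- For a pure state `ρ = |ψ⟩⟨ψ|` on `ℂ^m ⊗ ℂ^n`, the two reduced density matrices
have equal von Neumann entropy: `H(ρ_A) = H(ρ_B)`. -/
theorem vNEntropy_partialTraceSnd_eq_partialTraceFst {m n : ℕ}
    (ψ : Fin m × Fin n → ℂ) (hψ : (∑ p, Complex.normSq (ψ p)) = 1) :
    vNEntropy (partialTraceSnd (pureStateMatrix ψ)) =
      vNEntropy (partialTraceFst (pureStateMatrix ψ)) := by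
  set M : Matrix (Fin m) (Fin n) ℂ := Matrix.of fun i j => ψ (i, j) with hM
  have hA : partialTraceSnd (pureStateMatrix ψ) = M * Mᴴ := by
    ext i i'
    simp [partialTraceSnd, pureStateMatrix, mul_apply, hM]
  have hB : partialTraceFst (pureStateMatrix ψ) = (Mᴴ * M)ᵀ := by
    ext j j'
    simp [partialTraceFst, pureStateMatrix, mul_apply, hM, mul_comm]
  rw [hA, hB, vNEntropy_transpose (isHermitian_conjTranspose_mul_self M),
    vNEntropy_mul_conjTranspose_self]
end

section
/- (Klein's inequality.) Let ρ and σ be density matrices on ℂ^n with σ positive definite. Then the relative von Neumann entropy H(ρ‖σ) = trace(ρ log ρ) − trace(ρ log σ) is nonnegative, and H(ρ‖σ) = 0 if and only if ρ = σ. Here log ρ and log σ are defined by applying the real logarithm to the eigenvalues in a spectral decomposition (with the convention that eigenvalue 0 contributes 0 to trace(ρ log ρ)). -/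
open Matrix
open scoped ComplexOrder

/-- The logarithm of a Hermitian matrix, defined by applying the real logarithm to the
eigenvalues in a spectral decomposition (functional calculus).  With the convention
`Real.log 0 = 0`, an eigenvalue `0` contributes `0` to `trace (ρ * log ρ)`. -/
noncomputable def matLog {n : ℕ} (A : Matrix (Fin n) (Fin n) ℂ) (hA : A.IsHermitian) :
    Matrix (Fin n) (Fin n) ℂ :=
  (hA.eigenvectorUnitary : Matrix (Fin n) (Fin n) ℂ) *
    diagonal (fun i => (Real.log (hA.eigenvalues i) : ℂ)) *
      (star hA.eigenvectorUnitary : Matrix (Fin n) (Fin n) ℂ)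

/-- The trace of a product of two unitarily diagonalized matrices. -/
lemma trace_conj_diagonal_mul_conj_diagonal {m : Type*} [Fintype m] [DecidableEq m]
    (U V : unitaryGroup m ℂ) (a b : m → ℝ) :
    (((U : Matrix m m ℂ) * diagonal (fun i => (a i : ℂ)) * (star U : Matrix m m ℂ)) *
      ((V : Matrix m m ℂ) * diagonal (fun i => (b i : ℂ)) * (star V : Matrix m m ℂ))).trace.re =
      ∑ i, ∑ j, a i * b j * Complex.normSq ((star U * V : unitaryGroup m ℂ) i j) := by
  set W : Matrix m m ℂ := ((star U * V : unitaryGroup m ℂ) : Matrix m m ℂ) with hW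
  have hWstar : star W = (star V : Matrix m m ℂ) * U := by
    simp [hW]
  have htrace : (((U : Matrix m m ℂ) * diagonal (fun i => (a i : ℂ)) * (star U : Matrix m m ℂ)) *
      ((V : Matrix m m ℂ) * diagonal (fun i => (b i : ℂ)) * (star V : Matrix m m ℂ))).trace =
      (diagonal (fun i => (a i : ℂ)) * W * (diagonal (fun i => (b i : ℂ)) * star W)).trace := by
    rw [hWstar]
    simp only [Matrix.mul_assoc]
    rw [Matrix.trace_mul_comm]
    simp [hW, Matrix.mul_assoc]
  rw [htrace, Matrix.trace, Complex.re_sum]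
  refine Finset.sum_congr rfl fun i _ => ?_
  rw [Matrix.diag_apply, Matrix.mul_apply, Complex.re_sum]
  refine Finset.sum_congr rfl fun j _ => ?_
  rw [Matrix.diagonal_mul, Matrix.diagonal_mul, star_apply, Complex.star_def]
  have : (a i : ℂ) * W i j * (b j * (starRingEnd ℂ) (W i j)) =
      ((a i * b j * Complex.normSq (W i j) : ℝ) : ℂ) := by
    push_cast
    rw [← Complex.mul_conj]
    ring
  rw [this, Complex.ofReal_re]

lemma sum_normSq_row_unitaryGroup {m : Type*} [Fintype m] [DecidableEq m]
    (W : unitaryGroup m ℂ) (i : m) : ∑ j, Complex.normSq (W i j) = 1 := by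
  have h : ((W : Matrix m m ℂ) * star (W : Matrix m m ℂ)) i i = 1 := by
    rw [Unitary.mul_star_self_of_mem W.2, one_apply_eq]
  rw [Matrix.mul_apply] at h
  simp only [star_apply, Complex.star_def, Complex.mul_conj] at h
  exact_mod_cast h

lemma sum_normSq_col_unitaryGroup {m : Type*} [Fintype m] [DecidableEq m]
    (W : unitaryGroup m ℂ) (j : m) : ∑ i, Complex.normSq (W i j) = 1 := by
  simpa using sum_normSq_row_unitaryGroup (star W) j

/-- The scalar relative entropy, written through `klFun`. -/
lemma mul_klFun_div {p q : ℝ} (hp : 0 ≤ p) (hq : 0 < q) :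
    q * InformationTheory.klFun (p / q) = p * Real.log p - p * Real.log q - p + q := by
  rcases hp.eq_or_lt with rfl | hp
  · simp [InformationTheory.klFun]
  · rw [InformationTheory.klFun, Real.log_div hp.ne' hq.ne']
    field_simp
    ring

lemma eq_conj_diagonal_eigenvalues {m : Type*} [Fintype m] [DecidableEq m]
    {A : Matrix m m ℂ} (hA : A.IsHermitian) :
    A = (hA.eigenvectorUnitary : Matrix m m ℂ) * diagonal (fun i => (hA.eigenvalues i : ℂ)) *
      (star hA.eigenvectorUnitary : Matrix m m ℂ) := by
  conv_lhs => rw [hA.spectral_theorem, Unitary.conjStarAlgAut_apply]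
  rfl

/-- Two unitarily diagonalized matrices agree when their eigenvalues match on the support of the
transition matrix. -/
lemma conj_diagonal_eq_of_transition {m : Type*} [Fintype m] [DecidableEq m]
    (U V : unitaryGroup m ℂ) (a b : m → ℝ)
    (h : ∀ i j, (star U * V : unitaryGroup m ℂ) i j ≠ 0 → a i = b j) :
    (U : Matrix m m ℂ) * diagonal (fun i => (a i : ℂ)) * (star U : Matrix m m ℂ) =
      (V : Matrix m m ℂ) * diagonal (fun i => (b i : ℂ)) * (star V : Matrix m m ℂ) := by
  have hcomm : diagonal (fun i => (a i : ℂ)) * ((star U : Matrix m m ℂ) * V) =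
      (star U : Matrix m m ℂ) * V * diagonal (fun i => (b i : ℂ)) := by
    ext i j
    rw [Matrix.diagonal_mul, Matrix.mul_diagonal, mul_comm]
    by_cases hij : ((star U : Matrix m m ℂ) * V) i j = 0
    · simp [hij]
    · rw [h i j hij]
  have hU : (U : Matrix m m ℂ) * (star U : Matrix m m ℂ) = 1 := Unitary.mul_star_self_of_mem U.2
  have hV : (V : Matrix m m ℂ) * (star V : Matrix m m ℂ) = 1 := Unitary.mul_star_self_of_mem V.2
  calc (U : Matrix m m ℂ) * diagonal (fun i => (a i : ℂ)) * (star U : Matrix m m ℂ)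
      = U * (diagonal (fun i => (a i : ℂ)) * ((star U : Matrix m m ℂ) * V)) *
          (star V : Matrix m m ℂ) := by
        simp only [Matrix.mul_assoc, hV, Matrix.mul_one]
    _ = (U * (star U : Matrix m m ℂ)) * V * diagonal (fun i => (b i : ℂ)) *
          (star V : Matrix m m ℂ) := by
        rw [hcomm]
        simp only [Matrix.mul_assoc]
    _ = _ := by rw [hU, Matrix.one_mul]

lemma sum_eigenvalues_eq_one {n : ℕ} {A : Matrix (Fin n) (Fin n) ℂ} (hA : A.IsHermitian)
    (htr : A.trace = 1) : ∑ i, hA.eigenvalues i = 1 := by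
  have h := hA.trace_eq_sum_eigenvalues
  rw [htr, ← RCLike.ofReal_sum] at h
  exact Complex.ofReal_eq_one.1 h.symm

lemma trace_mul_matLog_re {n : ℕ} {A B : Matrix (Fin n) (Fin n) ℂ}
    (hA : A.IsHermitian) (hB : B.IsHermitian) :
    (A * matLog B hB).trace.re = ∑ i, ∑ j, hA.eigenvalues i * Real.log (hB.eigenvalues j) *
      Complex.normSq ((star hA.eigenvectorUnitary * hB.eigenvectorUnitary :
        unitaryGroup (Fin n) ℂ) i j) := by
  rw [← trace_conj_diagonal_mul_conj_diagonal, ← eq_conj_diagonal_eigenvalues hA]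
  rfl

lemma trace_mul_matLog_self_re {n : ℕ} {A : Matrix (Fin n) (Fin n) ℂ} (hA : A.IsHermitian) :
    (A * matLog A hA).trace.re = ∑ i, hA.eigenvalues i * Real.log (hA.eigenvalues i) := by
  rw [trace_mul_matLog_re hA hA]
  refine Finset.sum_congr rfl fun i _ => ?_
  rw [Unitary.star_mul_self, Finset.sum_eq_single i]
  · simp
  · intro j _ hj
    simp [one_apply_ne hj.symm]
  · simp

/-- The relative entropy as a sum of nonnegative terms weighted by transition probabilities. -/
lemma relative_entropy_eq_sum_klFun {n : ℕ} {ρ σ : Matrix (Fin n) (Fin n) ℂ}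
    (hρ : ρ.PosSemidef) (hρtr : ρ.trace = 1) (hσ : σ.PosDef) (hσtr : σ.trace = 1) :
    ((ρ * matLog ρ hρ.1).trace - (ρ * matLog σ hσ.1).trace).re =
      ∑ i, ∑ j, hσ.1.eigenvalues j *
        InformationTheory.klFun (hρ.1.eigenvalues i / hσ.1.eigenvalues j) *
        Complex.normSq ((star hρ.1.eigenvectorUnitary * hσ.1.eigenvectorUnitary :
          unitaryGroup (Fin n) ℂ) i j) := by
  rw [Complex.sub_re, trace_mul_matLog_self_re, trace_mul_matLog_re hρ.1 hσ.1]
  set W : unitaryGroup (Fin n) ℂ := star hρ.1.eigenvectorUnitary * hσ.1.eigenvectorUnitary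
  have hrow (f : Fin n → ℝ) : ∑ i, ∑ j, f i * Complex.normSq (W i j) = ∑ i, f i := by
    simp only [← Finset.mul_sum, sum_normSq_row_unitaryGroup, mul_one]
  have hcol (f : Fin n → ℝ) : ∑ i, ∑ j, f j * Complex.normSq (W i j) = ∑ j, f j := by
    rw [Finset.sum_comm]
    simp only [← Finset.mul_sum, sum_normSq_col_unitaryGroup, mul_one]
  simp only [mul_klFun_div (hρ.eigenvalues_nonneg _) (hσ.eigenvalues_pos _), add_mul, sub_mul,
    Finset.sum_add_distrib, Finset.sum_sub_distrib]
  rw [hrow, hrow, hcol, sum_eigenvalues_eq_one hρ.1 hρtr, sum_eigenvalues_eq_one hσ.1 hσtr]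
  ring

/-- **Klein's inequality.** For density matrices `ρ, σ` on `ℂⁿ` with `σ` positive
definite, the relative von Neumann entropy
`H(ρ‖σ) = trace (ρ log ρ) - trace (ρ log σ)` is nonnegative, and it vanishes iff
`ρ = σ`. -/
theorem klein_inequality {n : ℕ} (ρ σ : Matrix (Fin n) (Fin n) ℂ)
    (hρ : ρ.PosSemidef) (hρtr : ρ.trace = 1)
    (hσ : σ.PosDef) (hσtr : σ.trace = 1) :
    0 ≤ ((ρ * matLog ρ hρ.1).trace - (ρ * matLog σ hσ.1).trace).re ∧
      (((ρ * matLog ρ hρ.1).trace - (ρ * matLog σ hσ.1).trace).re = 0 ↔ ρ = σ) := by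
  have hnonneg (i j : Fin n) : 0 ≤ hσ.1.eigenvalues j *
        InformationTheory.klFun (hρ.1.eigenvalues i / hσ.1.eigenvalues j) *
        Complex.normSq ((star hρ.1.eigenvectorUnitary * hσ.1.eigenvectorUnitary :
          unitaryGroup (Fin n) ℂ) i j) :=
    mul_nonneg (mul_nonneg (hσ.eigenvalues_pos j).le (InformationTheory.klFun_nonneg
      (div_nonneg (hρ.eigenvalues_nonneg i) (hσ.eigenvalues_pos j).le))) (Complex.normSq_nonneg _)
  refine ⟨?_, fun h => ?_, ?_⟩
  · rw [relative_entropy_eq_sum_klFun hρ hρtr hσ hσtr]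
    exact Finset.sum_nonneg fun i _ => Finset.sum_nonneg fun j _ => hnonneg i j
  · rw [relative_entropy_eq_sum_klFun hρ hρtr hσ hσtr,
      Finset.sum_eq_zero_iff_of_nonneg
        fun i _ => Finset.sum_nonneg fun j _ => hnonneg i j] at h
    rw [eq_conj_diagonal_eigenvalues hρ.1, eq_conj_diagonal_eigenvalues hσ.1]
    refine conj_diagonal_eq_of_transition _ _ _ _ fun i j hij => ?_
    have hterm := (Finset.sum_eq_zero_iff_of_nonneg fun j _ => hnonneg i j).1
      (h i (Finset.mem_univ i)) j (Finset.mem_univ j)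
    have hq := hσ.eigenvalues_pos j
    have hkl := (mul_eq_zero.1 ((mul_eq_zero.1 hterm).resolve_right
      (Complex.normSq_eq_zero.not.2 hij))).resolve_left hq.ne'
    rw [InformationTheory.klFun_eq_zero_iff (div_nonneg (hρ.eigenvalues_nonneg i) hq.le),
      div_eq_one_iff_eq hq.ne'] at hkl
    exact hkl
  · rintro rfl
    simp
end

section
/- (Subadditivity of von Neumann entropy.) Let ρ_AB be a density matrix on ℂ^m ⊗ ℂ^n, with reduced density matrices ρ_A = trace_B(ρ_AB) and ρ_B = trace_A(ρ_AB). Then H(ρ_AB) ≤ H(ρ_A) + H(ρ_B), with equality if and only if ρ_AB = ρ_A ⊗ ρ_B (the Kronecker product). -/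
open Matrix
open scoped ComplexOrder Classical

open scoped Kronecker

/-- Gibbs-type scalar bound behind Klein's inequality. -/
lemma mul_log_sub_mul_log_nonneg {r q : ℝ} (hr : 0 ≤ r) (hq : 0 < q) :
    0 ≤ r * Real.log r - r * Real.log q - r + q ∧
      (r * Real.log r - r * Real.log q - r + q = 0 ↔ r = q) := by
  rcases hr.eq_or_lt with rfl | hr
  · simp [hq.le, hq.ne, hq.ne']
  · have key : r * Real.log r - r * Real.log q - r + q =
        r * (q / r - 1 - Real.log (q / r)) := by
      rw [Real.log_div hq.ne' hr.ne']
      field_simp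
      ring
    rw [key]
    have h1 := Real.log_le_sub_one_of_pos (div_pos hq hr)
    refine ⟨mul_nonneg hr.le (by linarith), fun h => ?_, fun h => ?_⟩
    · by_contra hne
      have h2 := Real.log_lt_sub_one_of_pos (div_pos hq hr)
        (fun h3 => hne ((div_eq_one_iff_eq hr.ne').1 h3).symm)
      have h3 : 0 < r * (q / r - 1 - Real.log (q / r)) := mul_pos hr (by linarith)
      exact h3.ne' h
    · subst h
      simp [hr.ne']

/-- Klein's inequality for a doubly stochastic weight `P`, with its equality case. -/
lemma sum_mul_log_le_of_doublyStochastic {κ ι : Type*} [Fintype κ] [Fintype ι]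
    {P : κ → ι → ℝ} {r : ι → ℝ} {q : κ → ℝ}
    (hP : ∀ k l, 0 ≤ P k l) (hrow : ∀ k, ∑ l, P k l = 1) (hcol : ∀ l, ∑ k, P k l = 1)
    (hr : ∀ l, 0 ≤ r l) (hq : ∀ k, 0 ≤ q k) (hsum : ∑ l, r l = ∑ k, q k)
    (hsupp : ∀ k l, q k = 0 → P k l * r l = 0) :
    ∑ k, (∑ l, P k l * r l) * Real.log (q k) ≤ ∑ l, r l * Real.log (r l) ∧
      (∑ k, (∑ l, P k l * r l) * Real.log (q k) = ∑ l, r l * Real.log (r l) ↔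
        ∀ k l, P k l ≠ 0 → r l = q k) := by
  have hexp : ∑ l, r l * Real.log (r l) - ∑ k, (∑ l, P k l * r l) * Real.log (q k) =
      ∑ k, ∑ l, P k l * (r l * Real.log (r l) - r l * Real.log (q k) - r l + q k) := by
    have hleft (g : ι → ℝ) : ∑ k, ∑ l, P k l * g l = ∑ l, g l := by
      rw [Finset.sum_comm]
      simp [← Finset.sum_mul, hcol]
    have hright : ∑ k, ∑ l, P k l * q k = ∑ k, q k := by
      simp [← Finset.sum_mul, hrow]
    simp only [mul_add, mul_sub, Finset.sum_add_distrib, Finset.sum_sub_distrib, hright,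
      hleft r, hleft fun l => r l * Real.log (r l), hsum, Finset.sum_mul, mul_assoc]
    ring
  have hterm (k l) :
      0 ≤ P k l * (r l * Real.log (r l) - r l * Real.log (q k) - r l + q k) ∧
      (P k l * (r l * Real.log (r l) - r l * Real.log (q k) - r l + q k) = 0 ↔
        (P k l ≠ 0 → r l = q k)) := by
    by_cases hPkl : P k l = 0
    · simp [hPkl]
    rcases (hq k).eq_or_lt with hk | hk
    · have hrl : r l = 0 := (mul_eq_zero.1 (hsupp k l hk.symm)).resolve_left hPkl
      simp [hrl, ← hk]
    · have h := mul_log_sub_mul_log_nonneg (hr l) hk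
      exact ⟨mul_nonneg (hP k l) h.1, by simp [hPkl, h.2]⟩
  refine ⟨sub_nonneg.1 (hexp ▸ Finset.sum_nonneg fun k _ => Finset.sum_nonneg fun l _ =>
    (hterm k l).1), ?_⟩
  rw [eq_comm, ← sub_eq_zero, hexp,
    Finset.sum_eq_zero_iff_of_nonneg fun k _ => Finset.sum_nonneg fun l _ => (hterm k l).1]
  simp only [Finset.mem_univ, true_implies]
  refine forall_congr' fun k => ?_
  rw [Finset.sum_eq_zero_iff_of_nonneg fun l _ => (hterm k l).1]
  simp only [Finset.mem_univ, true_implies]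
  exact forall_congr' fun l => (hterm k l).2

lemma partialTraceSnd_posSemidef {m n : ℕ}
    {ρ : Matrix (Fin m × Fin n) (Fin m × Fin n) ℂ} (hρ : ρ.PosSemidef) :
    (partialTraceSnd ρ).PosSemidef := by
  have h : partialTraceSnd ρ = ∑ j : Fin n, ρ.submatrix (·, j) (·, j) := by
    ext i i'
    simp [partialTraceSnd, Matrix.sum_apply]
  rw [h]
  exact posSemidef_sum _ fun j _ => hρ.submatrix _

lemma partialTraceFst_posSemidef {m n : ℕ}
    {ρ : Matrix (Fin m × Fin n) (Fin m × Fin n) ℂ} (hρ : ρ.PosSemidef) :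
    (partialTraceFst ρ).PosSemidef := by
  have h : partialTraceFst ρ = ∑ i : Fin m, ρ.submatrix (i, ·) (i, ·) := by
    ext j j'
    simp [partialTraceFst, Matrix.sum_apply]
  rw [h]
  exact posSemidef_sum _ fun i _ => hρ.submatrix _

lemma trace_partialTraceSnd {m n : ℕ} (ρ : Matrix (Fin m × Fin n) (Fin m × Fin n) ℂ) :
    (partialTraceSnd ρ).trace = ρ.trace := by
  simp [Matrix.trace, partialTraceSnd, Fintype.sum_prod_type]

lemma trace_partialTraceFst {m n : ℕ} (ρ : Matrix (Fin m × Fin n) (Fin m × Fin n) ℂ) :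
    (partialTraceFst ρ).trace = ρ.trace := by
  simp [Matrix.trace, partialTraceFst, Fintype.sum_prod_type_right]

lemma trace_mul_kronecker_one {m n : ℕ} (ρ : Matrix (Fin m × Fin n) (Fin m × Fin n) ℂ)
    (N : Matrix (Fin m) (Fin m) ℂ) :
    (ρ * (N ⊗ₖ (1 : Matrix (Fin n) (Fin n) ℂ))).trace = (partialTraceSnd ρ * N).trace := by
  simp only [Matrix.trace, Matrix.diag_apply, Matrix.mul_apply, partialTraceSnd,
    Fintype.sum_prod_type, kroneckerMap_apply, Matrix.one_apply, mul_ite, mul_one, mul_zero,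
    Finset.sum_ite_eq', Finset.mem_univ, if_true, Finset.sum_mul]
  exact Finset.sum_congr rfl fun i _ => Finset.sum_comm

lemma trace_mul_one_kronecker {m n : ℕ} (ρ : Matrix (Fin m × Fin n) (Fin m × Fin n) ℂ)
    (N : Matrix (Fin n) (Fin n) ℂ) :
    (ρ * ((1 : Matrix (Fin m) (Fin m) ℂ) ⊗ₖ N)).trace = (partialTraceFst ρ * N).trace := by
  simp only [Matrix.trace, Matrix.diag_apply, Matrix.mul_apply, partialTraceFst,
    Fintype.sum_prod_type_right, kroneckerMap_apply, Matrix.one_apply, ite_mul, one_mul, zero_mul,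
    mul_ite, mul_zero, Finset.sum_ite_eq', Finset.mem_univ, if_true, Finset.sum_mul]
  exact Finset.sum_congr rfl fun i _ => Finset.sum_comm

/-- Local basis changes commute with tracing out the second factor, on the diagonal. -/
lemma sum_diag_conj_kronecker_snd {m n : ℕ} (ρ : Matrix (Fin m × Fin n) (Fin m × Fin n) ℂ)
    (V : Matrix (Fin m) (Fin m) ℂ) {W : Matrix (Fin n) (Fin n) ℂ} (hW : W * Wᴴ = 1)
    (i : Fin m) :
    ∑ j, ((V ⊗ₖ W)ᴴ * ρ * (V ⊗ₖ W)) (i, j) (i, j) = (Vᴴ * partialTraceSnd ρ * V) i i := by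
  calc _ = (((V ⊗ₖ W)ᴴ * ρ * (V ⊗ₖ W)) *
        (Matrix.single i i (1 : ℂ) ⊗ₖ (1 : Matrix (Fin n) (Fin n) ℂ))).trace := by
        rw [trace_mul_kronecker_one, Matrix.trace_mul_single]
        simp [partialTraceSnd]
    _ = (ρ * ((V ⊗ₖ W) * (Matrix.single i i (1 : ℂ) ⊗ₖ (1 : Matrix (Fin n) (Fin n) ℂ)) *
        (V ⊗ₖ W)ᴴ)).trace := by
        rw [mul_assoc, mul_assoc, Matrix.trace_mul_comm]
        simp only [mul_assoc]
    _ = (ρ * ((V * Matrix.single i i (1 : ℂ) * Vᴴ) ⊗ₖ (1 : Matrix (Fin n) (Fin n) ℂ))).trace := by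
        rw [conjTranspose_kronecker, ← mul_kronecker_mul, ← mul_kronecker_mul, mul_one, hW]
    _ = _ := by
        rw [trace_mul_kronecker_one, ← mul_assoc, Matrix.trace_mul_comm, ← mul_assoc, ← mul_assoc,
          Matrix.trace_mul_single]
        simp

/-- Local basis changes commute with tracing out the first factor, on the diagonal. -/
lemma sum_diag_conj_kronecker_fst {m n : ℕ} (ρ : Matrix (Fin m × Fin n) (Fin m × Fin n) ℂ)
    {V : Matrix (Fin m) (Fin m) ℂ} (W : Matrix (Fin n) (Fin n) ℂ) (hV : V * Vᴴ = 1)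
    (j : Fin n) :
    ∑ i, ((V ⊗ₖ W)ᴴ * ρ * (V ⊗ₖ W)) (i, j) (i, j) = (Wᴴ * partialTraceFst ρ * W) j j := by
  calc _ = (((V ⊗ₖ W)ᴴ * ρ * (V ⊗ₖ W)) *
        ((1 : Matrix (Fin m) (Fin m) ℂ) ⊗ₖ Matrix.single j j (1 : ℂ))).trace := by
        rw [trace_mul_one_kronecker, Matrix.trace_mul_single]
        simp [partialTraceFst]
    _ = (ρ * ((V ⊗ₖ W) * ((1 : Matrix (Fin m) (Fin m) ℂ) ⊗ₖ Matrix.single j j (1 : ℂ)) *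
        (V ⊗ₖ W)ᴴ)).trace := by
        rw [mul_assoc, mul_assoc, Matrix.trace_mul_comm]
        simp only [mul_assoc]
    _ = (ρ * ((1 : Matrix (Fin m) (Fin m) ℂ) ⊗ₖ (W * Matrix.single j j (1 : ℂ) * Wᴴ))).trace := by
        rw [conjTranspose_kronecker, ← mul_kronecker_mul, ← mul_kronecker_mul, mul_one, hV]
    _ = _ := by
        rw [trace_mul_one_kronecker, ← mul_assoc, Matrix.trace_mul_comm, ← mul_assoc, ← mul_assoc,
          Matrix.trace_mul_single]
        simp

/-- Spectral decomposition of a density matrix, together with its entropy. -/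
lemma exists_spectral_decomposition {k : Type*} [Fintype k] [DecidableEq k] {ρ : Matrix k k ℂ}
    (hρ : ρ.PosSemidef) (htr : ρ.trace = 1) :
    ∃ (U : Matrix k k ℂ) (r : k → ℝ), Uᴴ * U = 1 ∧ U * Uᴴ = 1 ∧
      ρ = U * diagonal (fun i => (r i : ℂ)) * Uᴴ ∧ (∀ i, 0 ≤ r i) ∧ ∑ i, r i = 1 ∧
      vNEntropy ρ = -∑ i, r i * Real.log (r i) := by
  refine ⟨hρ.1.eigenvectorUnitary, hρ.1.eigenvalues, ?_, ?_, ?_, hρ.eigenvalues_nonneg, ?_, ?_⟩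
  · exact Unitary.coe_star_mul_self _
  · exact Unitary.coe_mul_star_self _
  · exact hρ.1.spectral_theorem
  · have h := hρ.1.trace_eq_sum_eigenvalues
    rw [htr] at h
    exact Complex.ofReal_injective (by simpa using h.symm)
  · simp [vNEntropy, hρ.1]

lemma sum_normSq_row {k : Type*} [Fintype k] [DecidableEq k] {S : Matrix k k ℂ}
    (hS : S * Sᴴ = 1) (i : k) : ∑ l, Complex.normSq (S i l) = 1 := by
  have h := congrFun (congrFun hS i) i
  simp only [Matrix.mul_apply, conjTranspose_apply, one_apply_eq, Complex.star_def,
    Complex.mul_conj] at h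
  exact_mod_cast h

lemma sum_normSq_col {k : Type*} [Fintype k] [DecidableEq k] {S : Matrix k k ℂ}
    (hS : Sᴴ * S = 1) (l : k) : ∑ i, Complex.normSq (S i l) = 1 := by
  simpa using sum_normSq_row (S := Sᴴ) (by simpa using hS) l

lemma mul_diagonal_mul_conjTranspose_apply_self {k : Type*} [Fintype k] [DecidableEq k]
    (S : Matrix k k ℂ) (r : k → ℝ) (i : k) :
    (S * diagonal (fun l => (r l : ℂ)) * Sᴴ) i i =
      ((∑ l, Complex.normSq (S i l) * r l : ℝ) : ℂ) := by
  rw [Matrix.mul_apply]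
  simp only [mul_diagonal, conjTranspose_apply, Complex.star_def,
    Complex.ofReal_sum, Complex.ofReal_mul, ← Complex.mul_conj]
  exact Finset.sum_congr rfl fun l _ => by ring

/-- Two unitary diagonalizations give the same matrix iff the change of basis only connects
equal eigenvalues. -/
lemma diagonalizations_eq_iff {k : Type*} [Fintype k] [DecidableEq k] {U X : Matrix k k ℂ}
    (hU : Uᴴ * U = 1) (hU' : U * Uᴴ = 1) (hX : Xᴴ * X = 1) (hX' : X * Xᴴ = 1) (r q : k → ℝ) :
    U * diagonal (fun l => (r l : ℂ)) * Uᴴ = X * diagonal (fun l => (q l : ℂ)) * Xᴴ ↔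
      ∀ i l, Complex.normSq ((Xᴴ * U) i l) ≠ 0 → r l = q i := by
  have hentry : (∀ i l, Complex.normSq ((Xᴴ * U) i l) ≠ 0 → r l = q i) ↔
      (Xᴴ * U) * diagonal (fun l => (r l : ℂ)) = diagonal (fun l => (q l : ℂ)) * (Xᴴ * U) := by
    rw [← Matrix.ext_iff]
    refine forall_congr' fun i => forall_congr' fun l => ?_
    rw [mul_diagonal, diagonal_mul, mul_comm, mul_eq_mul_right_iff, Complex.ofReal_inj, ne_eq,
      Complex.normSq_eq_zero]
    tauto
  rw [hentry]
  generalize diagonal (fun l => (r l : ℂ)) = R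
  generalize diagonal (fun l => (q l : ℂ)) = Q
  constructor <;> intro h
  · calc Xᴴ * U * R = Xᴴ * (U * R * Uᴴ) * U := by simp [mul_assoc, hU]
      _ = (Xᴴ * X) * Q * (Xᴴ * U) := by rw [h]; simp only [mul_assoc]
      _ = Q * (Xᴴ * U) := by rw [hX, one_mul]
  · calc U * R * Uᴴ = (X * Xᴴ) * U * R * Uᴴ := by rw [hX', one_mul]
      _ = X * (Xᴴ * U * R) * Uᴴ := by simp only [mul_assoc]
      _ = X * Q * Xᴴ := by rw [h]; simp [hU', mul_assoc]

/-- **Subadditivity of von Neumann entropy.** For a density matrix `ρ_AB` on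
`ℂ^m ⊗ ℂ^n` with reduced density matrices `ρ_A, ρ_B`, one has
`H(ρ_AB) ≤ H(ρ_A) + H(ρ_B)`, with equality iff `ρ_AB = ρ_A ⊗ ρ_B`. -/
theorem vNEntropy_subadditive {m n : ℕ}
    (ρ : Matrix (Fin m × Fin n) (Fin m × Fin n) ℂ)
    (hρ : ρ.PosSemidef) (hρtr : ρ.trace = 1) :
    vNEntropy ρ ≤ vNEntropy (partialTraceSnd ρ) + vNEntropy (partialTraceFst ρ) ∧
      (vNEntropy ρ = vNEntropy (partialTraceSnd ρ) + vNEntropy (partialTraceFst ρ) ↔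
        ρ = partialTraceSnd ρ ⊗ₖ partialTraceFst ρ) := by
  have hA := partialTraceSnd_posSemidef hρ
  have hB := partialTraceFst_posSemidef hρ
  obtain ⟨U, r, hU, hU', hρU, hr, hr1, hHρ⟩ := exists_spectral_decomposition hρ hρtr
  obtain ⟨V, a, hV, hV', hAV, ha, ha1, hHA⟩ :=
    exists_spectral_decomposition hA ((trace_partialTraceSnd ρ).trans hρtr)
  obtain ⟨W, b, hW, hW', hBW, hb, hb1, hHB⟩ :=
    exists_spectral_decomposition hB ((trace_partialTraceFst ρ).trans hρtr)
  set X := V ⊗ₖ W with hXdef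
  have hX : Xᴴ * X = 1 := by
    rw [hXdef, conjTranspose_kronecker, ← mul_kronecker_mul, hV, hW, one_kronecker_one]
  have hX' : X * Xᴴ = 1 := by
    rw [hXdef, conjTranspose_kronecker, ← mul_kronecker_mul, hV', hW', one_kronecker_one]
  let q : Fin m × Fin n → ℝ := fun k => a k.1 * b k.2
  have hσ : partialTraceSnd ρ ⊗ₖ partialTraceFst ρ =
      X * diagonal (fun k => (q k : ℂ)) * Xᴴ := by
    rw [hAV, hBW, mul_kronecker_mul, mul_kronecker_mul, diagonal_kronecker_diagonal,
      ← conjTranspose_kronecker]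
    simp [q, hXdef]
  set S := Xᴴ * U with hSdef
  have hS : Sᴴ * S = 1 := by
    rw [hSdef, conjTranspose_mul, conjTranspose_conjTranspose, mul_assoc, ← mul_assoc X, hX',
      one_mul, hU]
  have hS' : S * Sᴴ = 1 := by
    rw [hSdef, conjTranspose_mul, conjTranspose_conjTranspose, mul_assoc, ← mul_assoc U, hU',
      one_mul, hX]
  let P : Fin m × Fin n → Fin m × Fin n → ℝ := fun k l => Complex.normSq (S k l)
  let d : Fin m × Fin n → ℝ := fun k => ∑ l, P k l * r l
  have hd (k) : (Xᴴ * ρ * X) k k = (d k : ℂ) := by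
    rw [← mul_diagonal_mul_conjTranspose_apply_self, hρU, hSdef]
    simp only [conjTranspose_mul, conjTranspose_conjTranspose, mul_assoc]
  have hPr (k l) : 0 ≤ P k l * r l := mul_nonneg (Complex.normSq_nonneg _) (hr l)
  have hd0 (k) : 0 ≤ d k := Finset.sum_nonneg fun l _ => hPr k l
  have hda (i) : ∑ j, d (i, j) = a i := by
    have h := sum_diag_conj_kronecker_snd ρ V hW' i
    rw [← hXdef, hAV] at h
    simp only [hd] at h
    rw [show Vᴴ * (V * diagonal (fun i => (a i : ℂ)) * Vᴴ) * V =
      (Vᴴ * V) * diagonal (fun i => (a i : ℂ)) * (Vᴴ * V) by simp only [mul_assoc], hV, one_mul,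
      mul_one, diagonal_apply_eq] at h
    exact_mod_cast h
  have hdb (j) : ∑ i, d (i, j) = b j := by
    have h := sum_diag_conj_kronecker_fst ρ W hV' j
    rw [← hXdef, hBW] at h
    simp only [hd] at h
    rw [show Wᴴ * (W * diagonal (fun i => (b i : ℂ)) * Wᴴ) * W =
      (Wᴴ * W) * diagonal (fun i => (b i : ℂ)) * (Wᴴ * W) by simp only [mul_assoc], hW, one_mul,
      mul_one, diagonal_apply_eq] at h
    exact_mod_cast h
  have hd_zero_of_a (i j) (h : a i = 0) : d (i, j) = 0 := by
    rw [← hda, Finset.sum_eq_zero_iff_of_nonneg fun j _ => hd0 (i, j)] at h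
    exact h j (Finset.mem_univ j)
  have hd_zero_of_b (i j) (h : b j = 0) : d (i, j) = 0 := by
    rw [← hdb, Finset.sum_eq_zero_iff_of_nonneg fun i _ => hd0 (i, j)] at h
    exact h i (Finset.mem_univ i)
  have hlog : ∑ k, d k * Real.log (q k) =
      ∑ i, a i * Real.log (a i) + ∑ j, b j * Real.log (b j) := by
    have hsplit (k) : d k * Real.log (q k) =
        d k * Real.log (a k.1) + d k * Real.log (b k.2) := by
      by_cases hk : d k = 0
      · simp [hk]
      · rw [Real.log_mul (fun h => hk (hd_zero_of_a _ _ h)) (fun h => hk (hd_zero_of_b _ _ h)),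
          mul_add]
    simp only [hsplit, Finset.sum_add_distrib]
    congr 1
    · simp only [Fintype.sum_prod_type, ← Finset.sum_mul, hda]
    · simp only [Fintype.sum_prod_type_right, ← Finset.sum_mul, hdb]
  have hq1 : ∑ k, q k = 1 := by
    simp only [q, Fintype.sum_prod_type, ← Finset.mul_sum, hb1, mul_one, ha1]
  have hsupp (k l) (hk : q k = 0) : P k l * r l = 0 := by
    have hdk : d k = 0 :=
      (mul_eq_zero.1 hk).elim (hd_zero_of_a k.1 k.2) (hd_zero_of_b k.1 k.2)
    exact (Finset.sum_eq_zero_iff_of_nonneg fun l _ => hPr k l).1 hdk l (Finset.mem_univ l)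
  obtain ⟨hle, heq⟩ := sum_mul_log_le_of_doublyStochastic (P := P) (r := r) (q := q)
    (fun k l => Complex.normSq_nonneg _) (sum_normSq_row hS') (sum_normSq_col hS) hr
    (fun k => mul_nonneg (ha _) (hb _)) (hr1.trans hq1.symm) hsupp
  have hρσ : ρ = partialTraceSnd ρ ⊗ₖ partialTraceFst ρ ↔ ∀ k l, P k l ≠ 0 → r l = q k := by
    rw [← diagonalizations_eq_iff hU hU' hX hX' r q, hσ, ← hρU]
  change ∑ k, d k * _ ≤ _ at hle
  change ∑ k, d k * _ = _ ↔ _ at heq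
  rw [hlog] at hle heq
  rw [hHρ, hHA, hHB, hρσ, ← heq]
  refine ⟨by linarith, fun h => by linarith, fun h => by linarith⟩
end

section
/- (Araki–Lieb triangle inequality.) Let ρ_AB be a density matrix on ℂ^m ⊗ ℂ^n, with reduced density matrices ρ_A = trace_B(ρ_AB) and ρ_B = trace_A(ρ_AB). Then H(ρ_AB) ≥ |H(ρ_A) − H(ρ_B)|. -/
open Matrix
open scoped ComplexOrder Classical

section EntropyAux

open scoped Kronecker

variable {a b : Type*} [Fintype a] [Fintype b]

/-- Partial trace over the second factor, for arbitrary finite index types. -/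
def Matrix.traceRight (ρ : Matrix (a × b) (a × b) ℂ) : Matrix a a ℂ :=
  fun i i' => ∑ j, ρ (i, j) (i', j)

/-- Partial trace over the first factor, for arbitrary finite index types. -/
def Matrix.traceLeft (ρ : Matrix (a × b) (a × b) ℂ) : Matrix b b ℂ :=
  fun j j' => ∑ i, ρ (i, j) (i, j')

omit [Fintype a] in
theorem Matrix.IsHermitian.traceRight {ρ : Matrix (a × b) (a × b) ℂ} (h : ρ.IsHermitian) :
    ρ.traceRight.IsHermitian := by
  ext i i'
  simp only [conjTranspose_apply, Matrix.traceRight, star_sum]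
  exact Finset.sum_congr rfl fun j _ => h.apply _ _

omit [Fintype b] in
theorem Matrix.IsHermitian.traceLeft {ρ : Matrix (a × b) (a × b) ℂ} (h : ρ.IsHermitian) :
    ρ.traceLeft.IsHermitian := by
  ext i i'
  simp only [conjTranspose_apply, Matrix.traceLeft, star_sum]
  exact Finset.sum_congr rfl fun j _ => h.apply _ _

omit [Fintype a] in
theorem Matrix.traceLeft_swap (ρ : Matrix (a × b) (a × b) ℂ) :
    (ρ.submatrix Prod.swap Prod.swap).traceLeft = ρ.traceRight := rfl

omit [Fintype b] in
theorem Matrix.traceRight_swap (ρ : Matrix (a × b) (a × b) ℂ) :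
    (ρ.submatrix Prod.swap Prod.swap).traceRight = ρ.traceLeft := rfl

variable [DecidableEq a] [DecidableEq b]

omit [DecidableEq a] in
theorem Matrix.traceRight_conj_kronecker (ρ : Matrix (a × b) (a × b) ℂ) (U : Matrix a a ℂ)
    {V : Matrix b b ℂ} (hV : V * Vᴴ = 1) :
    ((U ⊗ₖ V)ᴴ * ρ * (U ⊗ₖ V)).traceRight = Uᴴ * ρ.traceRight * U := by
  have htrace (B : Matrix b b ℂ) : (Vᴴ * B * V).trace = B.trace := by
    rw [trace_mul_comm, ← mul_assoc, hV, one_mul]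
  ext i i'
  have hentry (j : b) : ((U ⊗ₖ V)ᴴ * ρ * (U ⊗ₖ V)) (i, j) (i', j) =
      ∑ x', ∑ x, star (U x i) * U x' i' *
        (Vᴴ * (of fun y y' => ρ (x, y) (x', y')) * V) j j := by
    simp only [mul_apply, conjTranspose_apply, kroneckerMap_apply, Fintype.sum_prod_type,
      Finset.sum_mul, Finset.mul_sum, star_mul', of_apply]
    refine Finset.sum_congr rfl fun x' _ => ?_
    rw [Finset.sum_comm]
    refine Finset.sum_congr rfl fun x _ => ?_
    refine Finset.sum_congr rfl fun y' _ => ?_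
    refine Finset.sum_congr rfl fun y _ => ?_
    ring
  have hsum (x x' : a) : ∑ j, (Vᴴ * (of fun y y' => ρ (x, y) (x', y')) * V) j j =
      ρ.traceRight x x' := htrace _
  have hconj : (Uᴴ * ρ.traceRight * U) i i' =
      ∑ x', ∑ x, star (U x i) * ρ.traceRight x x' * U x' i' := by
    simp only [mul_apply, conjTranspose_apply, Finset.sum_mul]
  rw [hconj]
  change ∑ j, ((U ⊗ₖ V)ᴴ * ρ * (U ⊗ₖ V)) (i, j) (i', j) = _
  simp only [hentry]
  rw [Finset.sum_comm]
  refine Finset.sum_congr rfl fun x' _ => ?_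
  rw [Finset.sum_comm]
  refine Finset.sum_congr rfl fun x _ => ?_
  rw [← Finset.mul_sum, hsum]
  ring

omit [DecidableEq b] in
theorem Matrix.traceLeft_conj_kronecker (ρ : Matrix (a × b) (a × b) ℂ) {U : Matrix a a ℂ}
    (V : Matrix b b ℂ) (hU : U * Uᴴ = 1) :
    ((U ⊗ₖ V)ᴴ * ρ * (U ⊗ₖ V)).traceLeft = Vᴴ * ρ.traceLeft * V := by
  have hswap : (U ⊗ₖ V).submatrix (Equiv.prodComm b a) (Equiv.prodComm b a) = V ⊗ₖ U := by
    ext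
    simp [mul_comm]
  rw [← traceRight_swap, ← traceRight_swap, ← traceRight_conj_kronecker _ V hU, ← hswap]
  congr 1
  change ((U ⊗ₖ V)ᴴ * ρ * (U ⊗ₖ V)).submatrix (Equiv.prodComm b a) (Equiv.prodComm b a) =
    _ * ρ.submatrix (Equiv.prodComm b a) (Equiv.prodComm b a) * _
  rw [conjTranspose_submatrix, submatrix_mul_equiv, submatrix_mul_equiv]

theorem Matrix.IsHermitian.exists_conj_eq_diagonal {A : Matrix a a ℂ} (hA : A.IsHermitian) :
    ∃ U : Matrix a a ℂ, U * Uᴴ = 1 ∧ Uᴴ * U = 1 ∧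
      Uᴴ * A * U = diagonal fun i => (hA.eigenvalues i : ℂ) := by
  refine ⟨hA.eigenvectorUnitary, Unitary.coe_mul_star_self _, Unitary.coe_star_mul_self _, ?_⟩
  have h := hA.conjStarAlgAut_star_eigenvectorUnitary
  rw [Unitary.conjStarAlgAut_star_apply] at h
  exact h

theorem vNEntropy_eq_sum_negMulLog {ρ : Matrix a a ℂ} (h : ρ.IsHermitian) :
    vNEntropy ρ = ∑ i, Real.negMulLog (h.eigenvalues i) := by
  simp [vNEntropy, h, Real.negMulLog]

theorem vNEntropy_eq_sum_roots {ρ : Matrix a a ℂ} (h : ρ.IsHermitian) :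
    vNEntropy ρ = (ρ.charpoly.roots.map fun z => Real.negMulLog z.re).sum := by
  rw [vNEntropy_eq_sum_negMulLog h, h.roots_charpoly_eq_eigenvalues]
  simp

theorem vNEntropy_eq_of_charpoly_eq {ρ : Matrix a a ℂ} {σ : Matrix b b ℂ} (hρ : ρ.IsHermitian)
    (hσ : σ.IsHermitian) (h : ρ.charpoly = σ.charpoly) : vNEntropy ρ = vNEntropy σ := by
  rw [vNEntropy_eq_sum_roots hρ, vNEntropy_eq_sum_roots hσ, h]

theorem vNEntropy_transpose_s10 {ρ : Matrix a a ℂ} (h : ρ.IsHermitian) :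
    vNEntropy ρᵀ = vNEntropy ρ :=
  vNEntropy_eq_of_charpoly_eq h.transpose h (charpoly_transpose ρ)

theorem vNEntropy_submatrix_equiv {ρ : Matrix a a ℂ} (h : ρ.IsHermitian) (e : b ≃ a) :
    vNEntropy (ρ.submatrix e e) = vNEntropy ρ :=
  vNEntropy_eq_of_charpoly_eq (h.submatrix e) h (charpoly_reindex e.symm ρ)

theorem vNEntropy_conjTranspose_mul_self (M : Matrix a b ℂ) :
    vNEntropy (Mᴴ * M) = vNEntropy (M * Mᴴ) := by
  rw [vNEntropy_eq_sum_roots (isHermitian_conjTranspose_mul_self M),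
    vNEntropy_eq_sum_roots (isHermitian_mul_conjTranspose_self M)]
  have h := congrArg (fun p => (p.roots.map fun z => Real.negMulLog z.re).sum)
    (charpoly_mul_comm' M Mᴴ)
  have hne (k : ℕ) {p : Polynomial ℂ} (hp : p.Monic) : Polynomial.X ^ k * p ≠ 0 :=
    ((Polynomial.monic_X_pow k).mul hp).ne_zero
  simp only [Polynomial.roots_mul (hne _ (charpoly_monic _)), Polynomial.roots_X_pow] at h
  simpa [Multiset.map_nsmul, Multiset.sum_nsmul] using h.symm

theorem vNEntropy_le_sum_negMulLog_diag {ρ : Matrix a a ℂ} (h : ρ.PosSemidef) :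
    vNEntropy ρ ≤ ∑ i, Real.negMulLog (ρ i i).re := by
  obtain ⟨U, hU, hU', hD⟩ := h.isHermitian.exists_conj_eq_diagonal
  have hρ : ρ = U * diagonal (fun i => (h.isHermitian.eigenvalues i : ℂ)) * Uᴴ := by
    rw [← hD]
    simp only [← mul_assoc, hU, one_mul]
    rw [mul_assoc, hU, mul_one]
  have hdiag (i : a) :
      (ρ i i).re = ∑ k, Complex.normSq (U i k) * h.isHermitian.eigenvalues k := by
    conv_lhs => rw [hρ]
    simp only [mul_apply (N := Uᴴ), mul_diagonal, conjTranspose_apply, Complex.re_sum]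
    refine Finset.sum_congr rfl fun k _ => ?_
    rw [mul_right_comm, Complex.star_def, Complex.mul_conj, ← Complex.ofReal_mul,
      Complex.ofReal_re]
  have hrow (i : a) : ∑ k, Complex.normSq (U i k) = 1 := by
    have := congrFun (congrFun hU i) i
    simp only [mul_apply, conjTranspose_apply, Complex.star_def, Complex.mul_conj,
      one_apply_eq] at this
    exact_mod_cast this
  have hcol (k : a) : ∑ i, Complex.normSq (U i k) = 1 := by
    have := congrFun (congrFun hU' k) k
    simp only [mul_apply, conjTranspose_apply, Complex.star_def, ← Complex.normSq_eq_conj_mul_self,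
      one_apply_eq] at this
    exact_mod_cast this
  calc vNEntropy ρ = ∑ k, Real.negMulLog (h.isHermitian.eigenvalues k) :=
        vNEntropy_eq_sum_negMulLog _
    _ = ∑ i, ∑ k, Complex.normSq (U i k) * Real.negMulLog (h.isHermitian.eigenvalues k) := by
        rw [Finset.sum_comm]
        simp only [← Finset.sum_mul, hcol, one_mul]
    _ ≤ ∑ i, Real.negMulLog (ρ i i).re := by
        refine Finset.sum_le_sum fun i _ => ?_
        rw [hdiag]
        exact Real.concaveOn_negMulLog.le_map_sum (fun k _ => Complex.normSq_nonneg _) (hrow i)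
          fun k _ => h.eigenvalues_nonneg k

omit [DecidableEq a] [DecidableEq b] in
/-- Subadditivity of the Shannon entropy. -/
theorem sum_negMulLog_le_sum_negMulLog_marginals {d : a → b → ℝ} (hd : ∀ i j, 0 ≤ d i j)
    (hsum : ∑ i, ∑ j, d i j = 1) :
    ∑ i, ∑ j, Real.negMulLog (d i j) ≤
      ∑ i, Real.negMulLog (∑ j, d i j) + ∑ j, Real.negMulLog (∑ i, d i j) := by
  set p : a → ℝ := fun i => ∑ j, d i j with hp
  set q : b → ℝ := fun j => ∑ i, d i j with hq
  have hq1 : ∑ j, q j = 1 := by rw [← hsum, Finset.sum_comm]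
  have hpt (i : a) (j : b) : Real.negMulLog (d i j) ≤
      -(d i j * Real.log (p i)) - d i j * Real.log (q j) + (p i * q j - d i j) := by
    have hdp : d i j ≤ p i := Finset.single_le_sum (fun j _ => hd i j) (Finset.mem_univ j)
    have hdq : d i j ≤ q j :=
      Finset.single_le_sum (f := fun i => d i j) (fun i _ => hd i j) (Finset.mem_univ i)
    rcases (hd i j).eq_or_lt with h0 | h0
    · rw [← h0] at hdp hdq ⊢
      simpa using mul_nonneg hdp hdq
    · have hp0 := h0.trans_le hdp
      have hq0 := h0.trans_le hdq
      have hlog := Real.log_le_sub_one_of_pos (div_pos (mul_pos hp0 hq0) h0)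
      rw [Real.log_div (mul_pos hp0 hq0).ne' h0.ne', Real.log_mul hp0.ne' hq0.ne'] at hlog
      have := mul_le_mul_of_nonneg_left hlog h0.le
      rw [mul_sub, mul_sub, mul_add, mul_div_cancel₀ _ h0.ne'] at this
      rw [Real.negMulLog]
      linarith
  have hp_log : ∑ i, ∑ j, d i j * Real.log (p i) = -∑ i, Real.negMulLog (p i) := by
    simp [Real.negMulLog, ← Finset.sum_mul, hp]
  have hq_log : ∑ i, ∑ j, d i j * Real.log (q j) = -∑ j, Real.negMulLog (q j) := by
    rw [Finset.sum_comm]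
    simp [Real.negMulLog, ← Finset.sum_mul, hq]
  have hpq : ∑ i, ∑ j, p i * q j = 1 := by
    simp_rw [← Finset.mul_sum, hq1, mul_one]
    exact hsum
  have h := Finset.sum_le_sum fun i (_ : i ∈ Finset.univ) =>
    Finset.sum_le_sum fun j (_ : j ∈ Finset.univ) => hpt i j
  simp only [Finset.sum_add_distrib, Finset.sum_sub_distrib, Finset.sum_neg_distrib, hp_log,
    hq_log, hpq] at h
  linarith

/-- Subadditivity of the von Neumann entropy. -/
theorem vNEntropy_le_traceRight_add_traceLeft {ρ : Matrix (a × b) (a × b) ℂ} (h : ρ.PosSemidef)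
    (htr : ρ.trace = 1) :
    vNEntropy ρ ≤ vNEntropy ρ.traceRight + vNEntropy ρ.traceLeft := by
  obtain ⟨U, hU, -, hDU⟩ := h.isHermitian.traceRight.exists_conj_eq_diagonal
  obtain ⟨V, hV, -, hDV⟩ := h.isHermitian.traceLeft.exists_conj_eq_diagonal
  set W := U ⊗ₖ V with hW
  have hWW : W * Wᴴ = 1 := by
    rw [hW, conjTranspose_kronecker, ← mul_kronecker_mul, hU, hV, one_kronecker_one]
  have hσ : (Wᴴ * ρ * W).PosSemidef := h.conjTranspose_mul_mul_same W
  have hchar : ρ.charpoly = (Wᴴ * ρ * W).charpoly := by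
    rw [charpoly_mul_comm, ← mul_assoc, hWW, one_mul]
  have hσtr : (Wᴴ * ρ * W).trace = 1 := by
    rw [trace_mul_comm, ← mul_assoc, hWW, one_mul, htr]
  have hR (i : a) : h.isHermitian.traceRight.eigenvalues i =
      ∑ j, ((Wᴴ * ρ * W) (i, j) (i, j)).re := by
    have := congrFun (congrFun ((traceRight_conj_kronecker ρ U hV).trans hDU) i) i
    rw [diagonal_apply_eq] at this
    rw [← Complex.re_sum]
    exact (congrArg Complex.re this).symm
  have hL (j : b) : h.isHermitian.traceLeft.eigenvalues j =
      ∑ i, ((Wᴴ * ρ * W) (i, j) (i, j)).re := by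
    have := congrFun (congrFun ((traceLeft_conj_kronecker ρ V hU).trans hDV) j) j
    rw [diagonal_apply_eq] at this
    rw [← Complex.re_sum]
    exact (congrArg Complex.re this).symm
  rw [vNEntropy_eq_of_charpoly_eq h.isHermitian hσ.isHermitian hchar,
    vNEntropy_eq_sum_negMulLog h.isHermitian.traceRight,
    vNEntropy_eq_sum_negMulLog h.isHermitian.traceLeft]
  simp only [hR, hL]
  refine (vNEntropy_le_sum_negMulLog_diag hσ).trans ?_
  rw [Fintype.sum_prod_type]
  refine sum_negMulLog_le_sum_negMulLog_marginals
    (fun i j => (Complex.le_def.mp hσ.diag_nonneg).1) ?_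
  rw [← Fintype.sum_prod_type', ← Complex.re_sum]
  exact congrArg Complex.re hσtr

/-- Purification together with subadditivity bounds the entropy of one marginal. -/
theorem vNEntropy_traceRight_le {ρ : Matrix (a × b) (a × b) ℂ} (h : ρ.PosSemidef)
    (htr : ρ.trace = 1) :
    vNEntropy ρ.traceRight ≤ vNEntropy ρ.traceLeft + vNEntropy ρ := by
  obtain ⟨B, hB⟩ : ∃ B : Matrix (a × b) (a × b) ℂ, ρ = Bᴴ * B := by
    open scoped MatrixOrder in
    exact CStarAlgebra.nonneg_iff_eq_star_mul_self.mp h.nonneg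
  let N : Matrix a (b × (a × b)) ℂ := of fun i x => Bᴴ (i, x.1) x.2
  have hN : N * Nᴴ = ρ.traceRight := by
    ext i i'
    simp [N, hB, mul_apply, Matrix.traceRight, Fintype.sum_prod_type]
  have hNR : (Nᴴ * N).traceRight = ρ.traceLeftᵀ := by
    ext j j'
    simp only [N, hB, mul_apply, Matrix.traceRight, Matrix.traceLeft, transpose_apply,
      conjTranspose_apply, of_apply, star_star]
    rw [Finset.sum_comm]
    simp only [mul_comm]
  have hNL : (Nᴴ * N).traceLeft = B * Bᴴ := by
    ext x x'
    simp only [N, mul_apply, Matrix.traceLeft, conjTranspose_apply, of_apply, star_star]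
    rw [Finset.sum_comm, Fintype.sum_prod_type]
  have hNtr : (Nᴴ * N).trace = 1 := by
    rw [trace_mul_comm, hN, ← htr]
    simp [trace, Matrix.traceRight, Fintype.sum_prod_type]
  have hsub := vNEntropy_le_traceRight_add_traceLeft (posSemidef_conjTranspose_mul_self N) hNtr
  rwa [vNEntropy_conjTranspose_mul_self, hN, hNR, hNL, vNEntropy_transpose_s10 h.isHermitian.traceLeft,
    ← vNEntropy_conjTranspose_mul_self, ← hB] at hsub

theorem vNEntropy_traceLeft_le {ρ : Matrix (a × b) (a × b) ℂ} (h : ρ.PosSemidef)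
    (htr : ρ.trace = 1) :
    vNEntropy ρ.traceLeft ≤ vNEntropy ρ.traceRight + vNEntropy ρ := by
  have htr' : (ρ.submatrix (Equiv.prodComm b a) (Equiv.prodComm b a)).trace = 1 := by
    rw [← htr]
    exact (Equiv.prodComm b a).sum_comp fun x => ρ x x
  have := vNEntropy_traceRight_le (h.submatrix (Equiv.prodComm b a)) htr'
  rwa [vNEntropy_submatrix_equiv h.isHermitian] at this

end EntropyAux

/-- **Araki–Lieb triangle inequality.** For a density matrix `ρ_AB` on `ℂ^m ⊗ ℂ^n`
with reduced density matrices `ρ_A, ρ_B`, one has `H(ρ_AB) ≥ |H(ρ_A) - H(ρ_B)|`. -/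
theorem vNEntropy_triangle_inequality {m n : ℕ}
    (ρ : Matrix (Fin m × Fin n) (Fin m × Fin n) ℂ)
    (hρ : ρ.PosSemidef) (hρtr : ρ.trace = 1) :
    |vNEntropy (partialTraceSnd ρ) - vNEntropy (partialTraceFst ρ)| ≤ vNEntropy ρ := by
  have hR := vNEntropy_traceRight_le hρ hρtr
  have hL := vNEntropy_traceLeft_le hρ hρtr
  change |vNEntropy ρ.traceRight - vNEntropy ρ.traceLeft| ≤ vNEntropy ρ
  rw [abs_le]
  constructor <;> linarith
end

section
/- (Strong subadditivity, conditional form.) Let ρ_ABC be a density matrix on ℂ^a ⊗ ℂ^b ⊗ ℂ^c, with reduced density matrices ρ_AC, ρ_BC, ρ_A, ρ_B obtained by partial trace. Then the conditional von Neumann entropies satisfy H(ρ_C|ρ_A) + H(ρ_C|ρ_B) ≥ 0, i.e., (H(ρ_AC) − H(ρ_A)) + (H(ρ_BC) − H(ρ_B)) ≥ 0. -/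
open Matrix
open scoped ComplexOrder Classical

variable {a b c : ℕ}

/-- Reduced density matrix on the `AB` factors: trace out `C`. -/
noncomputable def traceOutC
    (ρ : Matrix (Fin a × Fin b × Fin c) (Fin a × Fin b × Fin c) ℂ) :
    Matrix (Fin a × Fin b) (Fin a × Fin b) ℂ :=
  fun p q => ∑ k : Fin c, ρ (p.1, p.2, k) (q.1, q.2, k)

/-- Reduced density matrix on the `BC` factors: trace out `A`. -/
noncomputable def traceOutA
    (ρ : Matrix (Fin a × Fin b × Fin c) (Fin a × Fin b × Fin c) ℂ) :
    Matrix (Fin b × Fin c) (Fin b × Fin c) ℂ :=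
  fun p q => ∑ i : Fin a, ρ (i, p.1, p.2) (i, q.1, q.2)

/-- Reduced density matrix on the `AC` factors: trace out `B`. -/
noncomputable def traceOutB
    (ρ : Matrix (Fin a × Fin b × Fin c) (Fin a × Fin b × Fin c) ℂ) :
    Matrix (Fin a × Fin c) (Fin a × Fin c) ℂ :=
  fun p q => ∑ j : Fin b, ρ (p.1, j, p.2) (q.1, j, q.2)

/-- Reduced density matrix on the `B` factor: trace out `A` and `C`. -/
noncomputable def traceOutAC
    (ρ : Matrix (Fin a × Fin b × Fin c) (Fin a × Fin b × Fin c) ℂ) :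
    Matrix (Fin b) (Fin b) ℂ :=
  fun j j' => ∑ i : Fin a, ∑ k : Fin c, ρ (i, j, k) (i, j', k)

/-- Reduced density matrix on the `A` factor: trace out `B` and `C`. -/
noncomputable def traceOutBC
    (ρ : Matrix (Fin a × Fin b × Fin c) (Fin a × Fin b × Fin c) ℂ) :
    Matrix (Fin a) (Fin a) ℂ :=
  fun i i' => ∑ j : Fin b, ∑ k : Fin c, ρ (i, j, k) (i', j, k)

section Diagonalization

variable {n m : Type*} [Fintype n] [DecidableEq n] [Fintype m] [DecidableEq m]

theorem Matrix.IsHermitian.exists_diagonalization {M : Matrix n n ℂ} (hM : M.IsHermitian) :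
    ∃ U : Matrix n n ℂ, Uᴴ * U = 1 ∧
      M = U * diagonal (fun i => (hM.eigenvalues i : ℂ)) * Uᴴ := by
  refine ⟨hM.eigenvectorUnitary, ?_, ?_⟩
  · exact Unitary.coe_star_mul_self hM.eigenvectorUnitary
  · conv_lhs => rw [hM.spectral_theorem, Unitary.conjStarAlgAut_apply]
    rfl

theorem vNEntropy_eq_roots_charpoly {M : Matrix n n ℂ} (hM : M.IsHermitian) :
    vNEntropy M = (M.charpoly.roots.map fun z => Real.negMulLog z.re).sum := by
  rw [vNEntropy, dif_pos hM, hM.roots_charpoly_eq_eigenvalues, Multiset.map_map,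
    ← Finset.sum_neg_distrib]
  simp [Real.negMulLog]

theorem charpoly_unitary_conj_diagonal {U : Matrix n n ℂ} (hU : Uᴴ * U = 1) (d : n → ℂ) :
    (U * diagonal d * Uᴴ).charpoly = (diagonal d).charpoly := by
  rw [charpoly_mul_comm, ← mul_assoc, hU, one_mul]

theorem isHermitian_unitary_conj_diagonal (U : Matrix n n ℂ) (d : n → ℝ) :
    (U * diagonal (fun i => (d i : ℂ)) * Uᴴ).IsHermitian := by
  refine isHermitian_mul_mul_conjTranspose U ?_
  rw [IsHermitian, diagonal_conjTranspose]
  congr 1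
  ext i
  simp

theorem vNEntropy_of_diagonalization {M U : Matrix n n ℂ} {d : n → ℝ} (hU : Uᴴ * U = 1)
    (hM : M = U * diagonal (fun i => (d i : ℂ)) * Uᴴ) :
    vNEntropy M = ∑ i, Real.negMulLog (d i) := by
  have hH : M.IsHermitian := hM ▸ isHermitian_unitary_conj_diagonal U d
  rw [vNEntropy_eq_roots_charpoly hH, hM, charpoly_unitary_conj_diagonal hU, charpoly_diagonal,
    Polynomial.roots_prod]
  · simp
  · simp [Finset.prod_ne_zero_iff, Polynomial.X_sub_C_ne_zero]

theorem vNEntropy_transpose_s12 {M : Matrix n n ℂ} (hM : M.IsHermitian) :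
    vNEntropy Mᵀ = vNEntropy M := by
  rw [vNEntropy_eq_roots_charpoly hM, vNEntropy_eq_roots_charpoly hM.transpose, charpoly_transpose]

theorem vNEntropy_self_mul_conjTranspose (K : Matrix m n ℂ) :
    vNEntropy (K * Kᴴ) = vNEntropy (Kᴴ * K) := by
  rw [vNEntropy_eq_roots_charpoly (isHermitian_mul_conjTranspose_self K),
    vNEntropy_eq_roots_charpoly (isHermitian_conjTranspose_mul_self K)]
  have h := congrArg
    (fun P : Polynomial ℂ => (P.roots.map fun z : ℂ => Real.negMulLog z.re).sum)
    (charpoly_mul_comm' K Kᴴ)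
  have hX (k : ℕ) {P : Polynomial ℂ} (hP : P.Monic) :
      ((Polynomial.X ^ k * P).roots.map fun z : ℂ => Real.negMulLog z.re).sum =
        (P.roots.map fun z : ℂ => Real.negMulLog z.re).sum := by
    rw [Polynomial.roots_mul (((Polynomial.monic_X_pow k).mul hP).ne_zero)]
    simp [Multiset.map_nsmul, Multiset.sum_nsmul]
  simpa only [hX _ (charpoly_monic _)] using h

theorem tendsto_vNEntropy_add_smul_one {M : Matrix n n ℂ} (hM : M.IsHermitian) (s : ℝ) :
    Filter.Tendsto (fun ε : ℝ => vNEntropy (M + ((ε * s : ℝ) : ℂ) • (1 : Matrix n n ℂ)))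
      (nhdsWithin 0 (Set.Ioi 0)) (nhds (vNEntropy M)) := by
  obtain ⟨U, hU, hd⟩ := hM.exists_diagonalization
  have hU' : U * Uᴴ = 1 := mul_eq_one_comm.mp hU
  have key (ε : ℝ) : vNEntropy (M + ((ε * s : ℝ) : ℂ) • (1 : Matrix n n ℂ)) =
      ∑ i, Real.negMulLog (hM.eigenvalues i + ε * s) := by
    apply vNEntropy_of_diagonalization hU
    have : diagonal (fun i => ((hM.eigenvalues i + ε * s : ℝ) : ℂ)) =
        diagonal (fun i => (hM.eigenvalues i : ℂ)) + ((ε * s : ℝ) : ℂ) • (1 : Matrix n n ℂ) := by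
      rw [smul_one_eq_diagonal, diagonal_add]
      simp
    rw [this, mul_add, add_mul, ← hd, mul_smul_comm, smul_mul_assoc, mul_one, hU']
  have hM0 : vNEntropy M = ∑ i, Real.negMulLog (hM.eigenvalues i + 0 * s) := by
    simpa using key 0
  rw [hM0]
  simp_rw [key]
  apply Filter.Tendsto.mono_left _ nhdsWithin_le_nhds
  apply Continuous.tendsto (f := fun ε : ℝ => ∑ i, Real.negMulLog (hM.eigenvalues i + ε * s))
  fun_prop

end Diagonalization

section RelativeEntropy

variable {n m : Type*} [Fintype n] [DecidableEq n] [Fintype m] [DecidableEq m]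

/-- The concave quadratic form in `X` whose maximum is the quadratic form of the resolvent at `t`
of the relative modular operator of `σ` and `ρ`. -/
noncomputable def resolventForm (ρ σ : Matrix n n ℂ) (t : ℝ) (X : Matrix n n ℂ) : ℝ :=
  2 * (trace (ρ * X)).re - (trace (σ * (Xᴴ * X))).re - t * (trace (ρ * (X * Xᴴ))).re

theorem trace_diagonal_mul_mul_conjTranspose (d : n → ℝ) (Y Z : Matrix n n ℂ) :
    (trace (diagonal (fun i => (d i : ℂ)) * (Y * Zᴴ))).re =
      ∑ i, ∑ j, d i * (Y i j * star (Z i j)).re := by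
  simp only [trace, diag_apply, diagonal_mul, mul_apply (M := Y), conjTranspose_apply,
    Complex.re_sum, Complex.re_ofReal_mul, Finset.mul_sum]

theorem resolventForm_unitary_conj {U V : Matrix n n ℂ} (hU : Uᴴ * U = 1) (hV : Vᴴ * V = 1)
    (p q : n → ℝ) (t : ℝ) (Y : Matrix n n ℂ) :
    resolventForm (U * diagonal (fun i => (p i : ℂ)) * Uᴴ)
      (V * diagonal (fun i => (q i : ℂ)) * Vᴴ) t (U * Y * Vᴴ) =
      ∑ i, ∑ j, (2 * (p i * (Y i j * star ((Uᴴ * V) i j)).re)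
        - (q j + t * p i) * Complex.normSq (Y i j)) := by
  have hconj (W D Z : Matrix n n ℂ) :
      trace (W * D * Wᴴ * Z) = trace (D * (Wᴴ * Z * W)) := by
    rw [mul_assoc, mul_assoc, trace_mul_comm]
    simp only [mul_assoc]
  have e1 : Uᴴ * (U * Y * Vᴴ) * U = Y * (Uᴴ * V)ᴴ := by
    rw [conjTranspose_mul, conjTranspose_conjTranspose, ← mul_assoc, ← mul_assoc, ← mul_assoc,
      hU, one_mul]
  have e2 : Vᴴ * ((U * Y * Vᴴ)ᴴ * (U * Y * Vᴴ)) * V = Yᴴ * (Yᴴ)ᴴ := by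
    calc _ = (Vᴴ * V) * Yᴴ * (Uᴴ * U) * Y * (Vᴴ * V) := by
          simp only [conjTranspose_mul, conjTranspose_conjTranspose, mul_assoc]
      _ = _ := by simp [hU, hV]
  have e3 : Uᴴ * ((U * Y * Vᴴ) * (U * Y * Vᴴ)ᴴ) * U = Y * Yᴴ := by
    calc _ = (Uᴴ * U) * Y * (Vᴴ * V) * Yᴴ * (Uᴴ * U) := by
          simp only [conjTranspose_mul, conjTranspose_conjTranspose, mul_assoc]
      _ = _ := by simp [hU, hV]
  have hsq (z : ℂ) : (z * star z).re = Complex.normSq z := by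
    simp [Complex.normSq_apply]
  rw [resolventForm, hconj, hconj, hconj, e1, e2, e3, trace_diagonal_mul_mul_conjTranspose,
    trace_diagonal_mul_mul_conjTranspose, trace_diagonal_mul_mul_conjTranspose,
    Finset.sum_comm (f := fun i j => q i * _)]
  simp only [conjTranspose_apply, hsq, Complex.normSq_apply (star _), Finset.mul_sum,
    ← Finset.sum_sub_distrib]
  refine Finset.sum_congr rfl fun i _ => Finset.sum_congr rfl fun j _ => ?_
  simp [Complex.normSq_apply]
  ring

theorem resolventForm_le {U V : Matrix n n ℂ} (hU : Uᴴ * U = 1) (hV : Vᴴ * V = 1)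
    {p q : n → ℝ} (hp : ∀ i, 0 ≤ p i) (hq : ∀ j, 0 < q j) {t : ℝ} (ht : 0 ≤ t)
    (X : Matrix n n ℂ) :
    resolventForm (U * diagonal (fun i => (p i : ℂ)) * Uᴴ)
      (V * diagonal (fun i => (q i : ℂ)) * Vᴴ) t X ≤
      ∑ i, ∑ j, Complex.normSq ((Uᴴ * V) i j) * p i * (p i / (q j + t * p i)) := by
  have hX : X = U * (Uᴴ * X * V) * Vᴴ := by
    calc X = (U * Uᴴ) * X * (V * Vᴴ) := by
          rw [mul_eq_one_comm.mp hU, mul_eq_one_comm.mp hV, one_mul, mul_one]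
      _ = _ := by simp only [mul_assoc]
  rw [hX, resolventForm_unitary_conj hU hV]
  refine Finset.sum_le_sum fun i _ => Finset.sum_le_sum fun j _ => ?_
  set y := (Uᴴ * X * V) i j
  set w := (Uᴴ * V) i j
  have hr : 0 < q j + t * p i := add_pos_of_pos_of_nonneg (hq j) (mul_nonneg ht (hp i))
  set r := q j + t * p i
  have hsq : 0 ≤ Complex.normSq ((r : ℂ) * y - (p i : ℂ) * w) / r :=
    div_nonneg (Complex.normSq_nonneg _) hr.le
  have : Complex.normSq w * p i * (p i / r)
      - (2 * (p i * (y * star w).re) - r * Complex.normSq y) =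
      Complex.normSq ((r : ℂ) * y - (p i : ℂ) * w) / r := by
    field_simp
    simp [Complex.normSq_apply]
    ring
  linarith

theorem exists_resolventForm_eq {U V : Matrix n n ℂ} (hU : Uᴴ * U = 1) (hV : Vᴴ * V = 1)
    {p q : n → ℝ} (hp : ∀ i, 0 ≤ p i) (hq : ∀ j, 0 < q j) {t : ℝ} (ht : 0 ≤ t) :
    ∃ X, resolventForm (U * diagonal (fun i => (p i : ℂ)) * Uᴴ)
      (V * diagonal (fun i => (q i : ℂ)) * Vᴴ) t X =
      ∑ i, ∑ j, Complex.normSq ((Uᴴ * V) i j) * p i * (p i / (q j + t * p i)) := by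
  refine ⟨U * of (fun i j => ((p i / (q j + t * p i) : ℝ) : ℂ) * (Uᴴ * V) i j) * Vᴴ, ?_⟩
  rw [resolventForm_unitary_conj hU hV]
  refine Finset.sum_congr rfl fun i _ => Finset.sum_congr rfl fun j _ => ?_
  rw [of_apply]
  set w := (Uᴴ * V) i j
  have hr : 0 < q j + t * p i := add_pos_of_pos_of_nonneg (hq j) (mul_nonneg ht (hp i))
  set r := q j + t * p i
  rw [map_mul, Complex.normSq_ofReal, mul_assoc, Complex.re_ofReal_mul]
  have hsq : (w * star w).re = Complex.normSq w := by simp [Complex.normSq_apply]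
  rw [hsq]
  field_simp
  ring

theorem sum_normSq_mul_eq {U V : Matrix n n ℂ} (p : n → ℝ) (j : n) :
    ∑ i, Complex.normSq ((Uᴴ * V) i j) * p i =
      ((Vᴴ * (U * diagonal (fun i => (p i : ℂ)) * Uᴴ) * V) j j).re := by
  have : Vᴴ * (U * diagonal (fun i => (p i : ℂ)) * Uᴴ) * V =
      (Uᴴ * V)ᴴ * (diagonal (fun i => (p i : ℂ)) * (Uᴴ * V)) := by
    simp only [conjTranspose_mul, conjTranspose_conjTranspose, mul_assoc]
  rw [this, mul_apply, Complex.re_sum]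
  refine Finset.sum_congr rfl fun i _ => ?_
  rw [diagonal_mul, conjTranspose_apply]
  simp [Complex.normSq_apply]
  ring

theorem sum_normSq_unitary_row {W : Matrix n n ℂ} (hW : W * Wᴴ = 1) (i : n) :
    ∑ j, Complex.normSq (W i j) = 1 := by
  have := congrArg Complex.re (congrFun (congrFun hW i) i)
  simpa [mul_apply, Complex.normSq_apply] using this

end RelativeEntropy

section Monotonicity

open Filter Topology
open scoped Kronecker

theorem hasDerivAt_sum_mul_log {ι : Type*} [Fintype ι] {α u p : ι → ℝ}
    (hu : ∀ i, 0 < u i) (hp : ∀ i, 0 ≤ p i)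
    {t : ℝ} (ht : 0 ≤ t) :
    HasDerivAt (fun t : ℝ => ∑ i, α i * Real.log (u i + t * p i))
      (∑ i, α i * (p i / (u i + t * p i))) t := by
  refine HasDerivAt.fun_sum fun i _ => ?_
  have hpos : 0 < u i + t * p i := add_pos_of_pos_of_nonneg (hu i) (mul_nonneg ht (hp i))
  refine HasDerivAt.const_mul (α i) (HasDerivAt.log ?_ hpos.ne')
  simpa using ((hasDerivAt_id t).mul_const (p i)).const_add (u i)

theorem tendsto_sum_mul_log_sub {ι : Type*} [Fintype ι] {α u p : ι → ℝ}
    (hu : ∀ i, 0 < u i) (hp : ∀ i, 0 ≤ p i)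
    (hα : ∀ i, p i = 0 → α i = 0) :
    Tendsto (fun t : ℝ => ∑ i, α i * Real.log (u i + t * p i) - (∑ i, α i) * Real.log t) atTop
      (𝓝 (∑ i, α i * Real.log (p i))) := by
  simp_rw [Finset.sum_mul, ← Finset.sum_sub_distrib]
  refine tendsto_finsetSum _ fun i _ => ?_
  rcases (hp i).eq_or_lt with h | h
  · simp [hα i h.symm]
  · have h1 : Tendsto (fun t : ℝ => u i * t⁻¹ + p i) atTop (𝓝 (p i)) := by
      simpa using (tendsto_inv_atTop_zero.const_mul (u i)).add_const (p i)
    refine ((h1.log h.ne').const_mul (α i)).congr' ?_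
    filter_upwards [eventually_gt_atTop 0] with t ht
    have : u i * t⁻¹ + p i = (u i + t * p i) / t := by field_simp
    rw [this, Real.log_div (add_pos (hu i) (mul_pos ht h)).ne' ht.ne']
    ring

theorem conjTranspose_mul_mul_conjTranspose_self {k : Type*} [Fintype k] [DecidableEq k]
    {U V : Matrix k k ℂ} (hU : Uᴴ * U = 1)
    (hV : Vᴴ * V = 1) : (Uᴴ * V) * (Uᴴ * V)ᴴ = 1 := by
  rw [conjTranspose_mul, conjTranspose_conjTranspose, mul_assoc, ← mul_assoc V,
    mul_eq_one_comm.mp hV, one_mul, hU]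

theorem sum_normSq_mul_left {k : Type*} [Fintype k] [DecidableEq k]
    {U V : Matrix k k ℂ} (hU : Uᴴ * U = 1)
    (hV : Vᴴ * V = 1) (f g : k → ℝ) :
    ∑ i, ∑ j, Complex.normSq ((Uᴴ * V) i j) * f i * g i = ∑ i, f i * g i := by
  simp_rw [mul_assoc, ← Finset.sum_mul,
    sum_normSq_unitary_row (conjTranspose_mul_mul_conjTranspose_self hU hV), one_mul]

theorem trace_unitary_conj_diagonal {k : Type*} [Fintype k] [DecidableEq k]
    {U : Matrix k k ℂ} (hU : Uᴴ * U = 1)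
    (f : k → ℝ) : trace (U * diagonal (fun i => (f i : ℂ)) * Uᴴ) = ((∑ i, f i : ℝ) : ℂ) := by
  rw [trace_mul_comm, ← mul_assoc, hU, one_mul, trace_diagonal]
  push_cast
  rfl

/-- An inequality between the derivatives of two weighted sums of logarithms on `[0, ∞)`
integrates to an inequality at `0` relative to their asymptotics at infinity. -/
theorem sum_mul_log_sub_le {ι κ : Type*} [Fintype ι] [Fintype κ]
    {α u p : ι → ℝ} {β v r : κ → ℝ}
    (hu : ∀ i, 0 < u i) (hp : ∀ i, 0 ≤ p i) (hα : ∀ i, p i = 0 → α i = 0)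
    (hv : ∀ i, 0 < v i) (hr : ∀ i, 0 ≤ r i) (hβ : ∀ i, r i = 0 → β i = 0)
    (hsum : ∑ i, α i = ∑ k, β k)
    (hderiv : ∀ t : ℝ, 0 ≤ t →
      ∑ k, β k * (r k / (v k + t * r k)) ≤ ∑ i, α i * (p i / (u i + t * p i))) :
    ∑ i, α i * Real.log (u i) - ∑ k, β k * Real.log (v k) ≤
      ∑ i, α i * Real.log (p i) - ∑ k, β k * Real.log (r k) := by
  set G : ℝ → ℝ := fun t => ∑ i, α i * Real.log (u i + t * p i) -
    ∑ k, β k * Real.log (v k + t * r k) with hG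
  have hGd {t : ℝ} (ht : 0 ≤ t) :=
    (hasDerivAt_sum_mul_log (α := α) hu hp ht).sub
      (hasDerivAt_sum_mul_log (α := β) hv hr ht)
  have hmono : MonotoneOn G (Set.Ici 0) := by
    refine monotoneOn_of_deriv_nonneg (convex_Ici 0)
      (fun t ht => (hGd ht).continuousAt.continuousWithinAt)
      (fun t ht => ((hGd (interior_subset ht)).differentiableAt.differentiableWithinAt))
      fun t ht => ?_
    have ht' : (0 : ℝ) ≤ t := interior_subset ht
    have := (hGd ht').deriv
    exact (sub_nonneg.mpr (hderiv t ht')).trans_eq this.symm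
  have hGlim : Tendsto G atTop (𝓝 (∑ i, α i * Real.log (p i) - ∑ k, β k * Real.log (r k))) := by
    refine ((tendsto_sum_mul_log_sub hu hp hα).sub
      (tendsto_sum_mul_log_sub hv hr hβ)).congr fun t => ?_
    rw [hsum, hG]
    ring
  have h0 : G 0 = ∑ i, α i * Real.log (u i) - ∑ k, β k * Real.log (v k) := by simp [hG]
  rw [← h0]
  refine ge_of_tendsto hGlim ?_
  filter_upwards [eventually_ge_atTop 0] with t ht
  exact hmono Set.self_mem_Ici ht ht

variable {n m : Type*} [Fintype n] [DecidableEq n] [Fintype m] [DecidableEq m]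

/-- Monotonicity of the relative entropy under the dual of a `*`-homomorphism `φ`, expressed in
eigenbases of the four matrices involved. -/
theorem relativeEntropy_mono {U V : Matrix n n ℂ} {U' V' : Matrix m m ℂ}
    (hU : Uᴴ * U = 1) (hV : Vᴴ * V = 1) (hU' : U'ᴴ * U' = 1) (hV' : V'ᴴ * V' = 1)
    {p q : n → ℝ} {p' q' : m → ℝ} (hp : ∀ i, 0 ≤ p i) (hq : ∀ i, 0 < q i)
    (hp' : ∀ i, 0 ≤ p' i) (hq' : ∀ i, 0 < q' i)
    (φ : Matrix m m ℂ → Matrix n n ℂ) (hφ_one : φ 1 = 1)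
    (hφ_mul : ∀ X Y, φ (X * Y) = φ X * φ Y) (hφ_conj : ∀ X, φ Xᴴ = (φ X)ᴴ)
    (hφρ : ∀ X, trace (U * diagonal (fun i => (p i : ℂ)) * Uᴴ * φ X) =
      trace (U' * diagonal (fun i => (p' i : ℂ)) * U'ᴴ * X))
    (hφσ : ∀ X, trace (V * diagonal (fun i => (q i : ℂ)) * Vᴴ * φ X) =
      trace (V' * diagonal (fun i => (q' i : ℂ)) * V'ᴴ * X)) :
    ∑ i, ∑ j, Complex.normSq ((Uᴴ * V) i j) * p i * Real.log (q j) -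
      ∑ i, ∑ j, Complex.normSq ((U'ᴴ * V') i j) * p' i * Real.log (q' j) ≤
      ∑ i, p i * Real.log (p i) - ∑ i, p' i * Real.log (p' i) := by
  rw [← sum_normSq_mul_left hU hV p fun i => Real.log (p i),
    ← sum_normSq_mul_left hU' hV' p' fun i => Real.log (p' i)]
  simp_rw [← Fintype.sum_prod_type']
  refine sum_mul_log_sub_le (fun x => hq x.2) (fun x => hp x.1) (fun x hx => by simp [hx])
    (fun x => hq' x.2) (fun x => hp' x.1) (fun x hx => by simp [hx]) ?_ fun t ht => ?_
  · simp_rw [Fintype.sum_prod_type]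
    have h1 := sum_normSq_mul_left hU hV p fun _ => 1
    have h2 := sum_normSq_mul_left hU' hV' p' fun _ => 1
    simp only [mul_one] at h1 h2
    rw [h1, h2]
    have := hφρ 1
    rwa [hφ_one, mul_one, mul_one, trace_unitary_conj_diagonal hU,
      trace_unitary_conj_diagonal hU', Complex.ofReal_inj] at this
  · simp_rw [Fintype.sum_prod_type]
    obtain ⟨X, hX⟩ := exists_resolventForm_eq hU' hV' hp' hq' ht
    rw [← hX]
    refine le_trans (le_of_eq ?_) (resolventForm_le hU hV hp hq ht (φ X))
    simp only [resolventForm, ← hφ_conj, ← hφ_mul, hφρ, hφσ]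

theorem sum_normSq_mul_log_of_partialTrace {k r : Type*} [Fintype k] [DecidableEq k] [Fintype r]
    [DecidableEq r] {U : Matrix (k × r) (k × r) ℂ} {V : Matrix k k ℂ} (hV : Vᴴ * V = 1)
    {p : k × r → ℝ} {q : k → ℝ}
    (h : ∀ i j, ∑ x, (U * diagonal (fun i => (p i : ℂ)) * Uᴴ) (i, x) (j, x) =
      (V * diagonal (fun i => (q i : ℂ)) * Vᴴ) i j) :
    ∑ i, ∑ j, Complex.normSq ((Uᴴ * (V ⊗ₖ (1 : Matrix r r ℂ))) i j) * p i *
      Real.log (q j.1) = ∑ i, q i * Real.log (q i) := by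
  rw [Finset.sum_comm]
  simp_rw [← Finset.sum_mul, sum_normSq_mul_eq]
  rw [Fintype.sum_prod_type]
  simp_rw [← Finset.sum_mul, ← Complex.re_sum]
  refine Finset.sum_congr rfl fun j _ => ?_
  congr 1
  set M := U * diagonal (fun i => (p i : ℂ)) * Uᴴ
  have h1 (x : r) : ((V ⊗ₖ (1 : Matrix r r ℂ))ᴴ * M *
      (V ⊗ₖ (1 : Matrix r r ℂ))) (j, x) (j, x) =
      ∑ l, ∑ i, star (V i j) * M (i, x) (l, x) * V l j := by
    simp [mul_apply, Fintype.sum_prod_type, one_apply, Finset.sum_mul, apply_ite, ite_mul]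
  have h2 : Vᴴ * (V * diagonal (fun i => (q i : ℂ)) * Vᴴ) * V =
      diagonal (fun i => (q i : ℂ)) := by
    calc _ = (Vᴴ * V) * diagonal (fun i => (q i : ℂ)) * (Vᴴ * V) := by simp only [mul_assoc]
      _ = _ := by rw [hV, one_mul, mul_one]
  have h3 := congrFun (congrFun h2 j) j
  rw [diagonal_apply_eq] at h3
  rw [← Complex.ofReal_re (q j), ← h3]
  congr 1
  simp_rw [h1]
  rw [Finset.sum_comm, mul_apply]
  refine Finset.sum_congr rfl fun l _ => ?_
  rw [Finset.sum_comm, mul_apply, Finset.sum_mul]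
  refine Finset.sum_congr rfl fun i _ => ?_
  rw [← h, conjTranspose_apply, Finset.mul_sum, Finset.sum_mul]

end Monotonicity

section StrongSubadditivity

open scoped Kronecker

variable {A C R : Type*} [DecidableEq C]

/-- The ampliation `X ↦ X ⊗ 1` inserting the identity on the middle factor. -/
def ampliation (X : Matrix (A × R) (A × R) ℂ) : Matrix ((A × C) × R) ((A × C) × R) ℂ :=
  fun x y => if x.1.2 = y.1.2 then X (x.1.1, x.2) (y.1.1, y.2) else 0

theorem ampliation_one [DecidableEq A] [DecidableEq R] :
    ampliation (C := C) (1 : Matrix (A × R) (A × R) ℂ) = 1 := by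
  ext ⟨⟨i, j⟩, k⟩ ⟨⟨i', j'⟩, k'⟩
  simp only [ampliation, one_apply, Prod.mk.injEq, ← ite_and]
  congr 1
  simp only [eq_iff_iff]
  tauto

theorem ampliation_mul [Fintype A] [Fintype C] [Fintype R] (X Y : Matrix (A × R) (A × R) ℂ) :
    ampliation (C := C) (X * Y) = ampliation X * ampliation Y := by
  ext ⟨⟨i, j⟩, k⟩ ⟨⟨i', j'⟩, k'⟩
  simp only [ampliation, mul_apply, Fintype.sum_prod_type, ite_mul, zero_mul, mul_ite, mul_zero]
  split_ifs with h
  · subst h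
    refine Finset.sum_congr rfl fun x _ => ?_
    rw [Finset.sum_comm]
    refine Finset.sum_congr rfl fun y _ => ?_
    rw [Finset.sum_eq_single j] <;> simp +contextual
  · symm
    refine Finset.sum_eq_zero fun x _ => Finset.sum_eq_zero fun y _ => Finset.sum_eq_zero
      fun z _ => ?_
    grind

theorem ampliation_conjTranspose (X : Matrix (A × R) (A × R) ℂ) :
    ampliation (C := C) Xᴴ = (ampliation X)ᴴ := by
  ext ⟨⟨i, j⟩, k⟩ ⟨⟨i', j'⟩, k'⟩
  simp only [ampliation, conjTranspose_apply, eq_comm (a := j), apply_ite star, star_zero]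

theorem trace_mul_ampliation [Fintype A] [Fintype C] [Fintype R]
    {M : Matrix ((A × C) × R) ((A × C) × R) ℂ}
    {M' : Matrix (A × R) (A × R) ℂ}
    (h : ∀ i j x y, M' (i, x) (j, y) = ∑ k, M ((i, k), x) ((j, k), y))
    (X : Matrix (A × R) (A × R) ℂ) : trace (M * ampliation X) = trace (M' * X) := by
  simp only [trace, diag_apply, mul_apply, Fintype.sum_prod_type, h, ampliation, mul_ite, mul_zero,
    Finset.sum_mul]
  refine Finset.sum_congr rfl fun i _ => ?_
  rw [Finset.sum_comm]
  refine Finset.sum_congr rfl fun x _ => ?_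
  rw [Finset.sum_comm]
  refine Finset.sum_congr rfl fun j _ => ?_
  rw [Finset.sum_comm (f := fun y k => M ((i, k), x) ((j, k), y) * X (j, y) (i, x))]
  trans ∑ l, ∑ k, ∑ y, if l = k then M ((i, k), x) ((j, l), y) * X (j, y) (i, x) else 0
  · exact Finset.sum_comm
  · refine Finset.sum_congr rfl fun l _ => ?_
    rw [Finset.sum_eq_single l] <;> simp +contextual
    grind

theorem kronecker_one_conjTranspose_mul_self [Fintype A] [Fintype R] [DecidableEq A] [DecidableEq R]
    {V : Matrix A A ℂ} (hV : Vᴴ * V = 1) :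
    (V ⊗ₖ (1 : Matrix R R ℂ))ᴴ * (V ⊗ₖ (1 : Matrix R R ℂ)) = 1 := by
  rw [conjTranspose_kronecker, ← mul_kronecker_mul, hV, conjTranspose_one, one_mul,
    one_kronecker_one]

theorem kronecker_one_conj_diagonal [Fintype A] [Fintype R] [DecidableEq A] [DecidableEq R]
    (V : Matrix A A ℂ) (q : A → ℝ) :
    (V ⊗ₖ (1 : Matrix R R ℂ)) * diagonal (fun x : A × R => (q x.1 : ℂ)) *
      (V ⊗ₖ (1 : Matrix R R ℂ))ᴴ =
      (V * diagonal (fun i => (q i : ℂ)) * Vᴴ) ⊗ₖ (1 : Matrix R R ℂ) := by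
  have : diagonal (fun x : A × R => (q x.1 : ℂ)) =
      diagonal (fun i => (q i : ℂ)) ⊗ₖ (1 : Matrix R R ℂ) := by
    rw [← diagonal_one, diagonal_kronecker_diagonal]
    simp
  rw [this, conjTranspose_kronecker, ← mul_kronecker_mul, ← mul_kronecker_mul, conjTranspose_one,
    one_mul, one_mul]

/-- **Strong subadditivity** for a positive semidefinite matrix on `A ⊗ C ⊗ R` whose marginals on
`A ⊗ C` and `A` are nonsingular. -/
theorem vNEntropy_strong_subadditivity_of_posDef [Fintype A] [Fintype C] [Fintype R]
    [DecidableEq A] [DecidableEq R]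
    {τ : Matrix ((A × C) × R) ((A × C) × R) ℂ}
    {τAR : Matrix (A × R) (A × R) ℂ} {τAC : Matrix (A × C) (A × C) ℂ} {τA : Matrix A A ℂ}
    (hτ : τ.PosSemidef) (hτAR : τAR.PosSemidef) (hτAC : τAC.PosDef) (hτA : τA.PosDef)
    (hAR : ∀ i j x y, τAR (i, x) (j, y) = ∑ k, τ ((i, k), x) ((j, k), y))
    (hAC : ∀ i j, ∑ x, τ (i, x) (j, x) = τAC i j)
    (hA : ∀ i j, ∑ x, τAR (i, x) (j, x) = τA i j) :
    vNEntropy τ + vNEntropy τA ≤ vNEntropy τAC + vNEntropy τAR := by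
  obtain ⟨U, hU, hUτ⟩ := hτ.1.exists_diagonalization
  obtain ⟨U', hU', hUτ'⟩ := hτAR.1.exists_diagonalization
  obtain ⟨V, hV, hVτ⟩ := hτAC.1.exists_diagonalization
  obtain ⟨V', hV', hVτ'⟩ := hτA.1.exists_diagonalization
  have hAC' (i j : A) : τA i j = ∑ k, τAC (i, k) (j, k) := by
    simp_rw [← hA, ← hAC, hAR]
    exact Finset.sum_comm
  have := relativeEntropy_mono (φ := ampliation) hU (kronecker_one_conjTranspose_mul_self hV) hU'
    (kronecker_one_conjTranspose_mul_self hV') hτ.eigenvalues_nonneg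
    (q := fun x => hτAC.1.eigenvalues x.1) (fun x => hτAC.eigenvalues_pos x.1)
    hτAR.eigenvalues_nonneg
    (q' := fun x => hτA.1.eigenvalues x.1) (fun x => hτA.eigenvalues_pos x.1)
    ampliation_one ampliation_mul ampliation_conjTranspose
    (fun X => by rw [← hUτ, ← hUτ', trace_mul_ampliation hAR]) (fun X => by
      rw [kronecker_one_conj_diagonal, kronecker_one_conj_diagonal, ← hVτ, ← hVτ']
      refine trace_mul_ampliation (fun i j x y => ?_) X
      simp only [kronecker_apply, ← Finset.sum_mul, hAC'])
  rw [sum_normSq_mul_log_of_partialTrace hV (by rwa [← hUτ, ← hVτ]),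
    sum_normSq_mul_log_of_partialTrace hV' (by rwa [← hUτ', ← hVτ'])] at this
  rw [vNEntropy_of_diagonalization hU hUτ, vNEntropy_of_diagonalization hU' hUτ',
    vNEntropy_of_diagonalization hV hVτ, vNEntropy_of_diagonalization hV' hVτ']
  simp only [Real.negMulLog_def, neg_mul, Finset.sum_neg_distrib]
  linarith

end StrongSubadditivity

section PartialTrace

theorem traceOutA_posSemidef {ρ : Matrix (Fin a × Fin b × Fin c) (Fin a × Fin b × Fin c) ℂ}
    (hρ : ρ.PosSemidef) : (traceOutA ρ).PosSemidef := by
  have : traceOutA ρ = ∑ i, ρ.submatrix (fun p => (i, p.1, p.2)) (fun p => (i, p.1, p.2)) := by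
    ext p q
    simp [traceOutA, Matrix.sum_apply]
  exact this ▸ posSemidef_sum _ fun i _ => hρ.submatrix _

theorem traceOutB_posSemidef {ρ : Matrix (Fin a × Fin b × Fin c) (Fin a × Fin b × Fin c) ℂ}
    (hρ : ρ.PosSemidef) : (traceOutB ρ).PosSemidef := by
  have : traceOutB ρ = ∑ j, ρ.submatrix (fun p => (p.1, j, p.2)) (fun p => (p.1, j, p.2)) := by
    ext p q
    simp [traceOutB, Matrix.sum_apply]
  exact this ▸ posSemidef_sum _ fun i _ => hρ.submatrix _

theorem traceOutAC_posSemidef {ρ : Matrix (Fin a × Fin b × Fin c) (Fin a × Fin b × Fin c) ℂ}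
    (hρ : ρ.PosSemidef) : (traceOutAC ρ).PosSemidef := by
  have : traceOutAC ρ = ∑ i, ∑ k, ρ.submatrix (fun j => (i, j, k)) (fun j => (i, j, k)) := by
    ext p q
    simp [traceOutAC, Matrix.sum_apply]
  exact this ▸ posSemidef_sum _ fun i _ => posSemidef_sum _ fun k _ => hρ.submatrix _

theorem traceOutBC_posSemidef {ρ : Matrix (Fin a × Fin b × Fin c) (Fin a × Fin b × Fin c) ℂ}
    (hρ : ρ.PosSemidef) : (traceOutBC ρ).PosSemidef := by
  have : traceOutBC ρ = ∑ j, ∑ k, ρ.submatrix (fun i => (i, j, k)) (fun i => (i, j, k)) := by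
    ext p q
    simp [traceOutBC, Matrix.sum_apply]
  exact this ▸ posSemidef_sum _ fun i _ => posSemidef_sum _ fun k _ => hρ.submatrix _

theorem traceOutA_add_smul_one (ρ : Matrix (Fin a × Fin b × Fin c) (Fin a × Fin b × Fin c) ℂ)
    (ε : ℝ) : traceOutA (ρ + (ε : ℂ) • 1) = traceOutA ρ + ((ε * a : ℝ) : ℂ) • 1 := by
  ext p q
  simp [traceOutA, Finset.sum_add_distrib, one_apply, Prod.ext_iff, mul_comm]

theorem traceOutB_add_smul_one (ρ : Matrix (Fin a × Fin b × Fin c) (Fin a × Fin b × Fin c) ℂ)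
    (ε : ℝ) : traceOutB (ρ + (ε : ℂ) • 1) = traceOutB ρ + ((ε * b : ℝ) : ℂ) • 1 := by
  ext p q
  simp [traceOutB, Finset.sum_add_distrib, one_apply, Prod.ext_iff, mul_comm]

theorem traceOutAC_add_smul_one (ρ : Matrix (Fin a × Fin b × Fin c) (Fin a × Fin b × Fin c) ℂ)
    (ε : ℝ) : traceOutAC (ρ + (ε : ℂ) • 1) = traceOutAC ρ + ((ε * (a * c) : ℝ) : ℂ) • 1 := by
  ext p q
  simp [traceOutAC, Finset.sum_add_distrib, one_apply, mul_comm, mul_left_comm]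

theorem traceOutBC_add_smul_one (ρ : Matrix (Fin a × Fin b × Fin c) (Fin a × Fin b × Fin c) ℂ)
    (ε : ℝ) : traceOutBC (ρ + (ε : ℂ) • 1) = traceOutBC ρ + ((ε * (b * c) : ℝ) : ℂ) • 1 := by
  ext p q
  simp [traceOutBC, Finset.sum_add_distrib, one_apply, mul_comm, mul_left_comm]

theorem Matrix.PosSemidef.exists_eq_mul_conjTranspose {n : Type*} [Fintype n] [DecidableEq n]
    {M : Matrix n n ℂ} (hM : M.PosSemidef) : ∃ K : Matrix n n ℂ, M = K * Kᴴ := by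
  obtain ⟨U, -, hU⟩ := hM.1.exists_diagonalization
  refine ⟨U * diagonal fun i => (√(hM.1.eigenvalues i) : ℂ), ?_⟩
  rw [conjTranspose_mul, diagonal_conjTranspose, mul_assoc, ← mul_assoc (diagonal _),
    diagonal_mul_diagonal, ← mul_assoc]
  conv_lhs => rw [hU]
  congr 3
  ext i
  simp [← Complex.ofReal_mul, Real.mul_self_sqrt (hM.eigenvalues_nonneg i)]

theorem vNEntropy_conditional_of_posDef
    {ρ : Matrix (Fin a × Fin b × Fin c) (Fin a × Fin b × Fin c) ℂ} (hρ : ρ.PosSemidef)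
    (hAC : (traceOutB ρ).PosDef) (hA : (traceOutBC ρ).PosDef) :
    vNEntropy (traceOutAC ρ) + vNEntropy (traceOutBC ρ) ≤
      vNEntropy (traceOutB ρ) + vNEntropy (traceOutA ρ) := by
  obtain ⟨K, hK⟩ := hρ.exists_eq_mul_conjTranspose
  let N : Matrix (Fin b) ((Fin a × Fin c) × (Fin a × Fin b × Fin c)) ℂ :=
    of fun j x => K (x.1.1, j, x.1.2) x.2
  let L : Matrix (Fin b × Fin c) (Fin a × (Fin a × Fin b × Fin c)) ℂ :=
    of fun y x => K (x.1, y.1, y.2) x.2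
  have hN : traceOutAC ρ = N * Nᴴ := by
    ext j j'
    rw [mul_apply, Fintype.sum_prod_type, Fintype.sum_prod_type]
    simp only [traceOutAC, hK, mul_apply (M := K)]
    rfl
  have hL : traceOutA ρ = L * Lᴴ := by
    ext j j'
    rw [mul_apply, Fintype.sum_prod_type]
    simp only [traceOutA, hK, mul_apply (M := K)]
    rfl
  rw [hN, hL, vNEntropy_self_mul_conjTranspose, vNEntropy_self_mul_conjTranspose,
    ← vNEntropy_transpose_s12 hAC.1, ← vNEntropy_transpose_s12 hA.1]
  refine vNEntropy_strong_subadditivity_of_posDef (posSemidef_conjTranspose_mul_self N)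
    (posSemidef_conjTranspose_mul_self L) hAC.transpose hA.transpose (fun i i' x y => ?_)
    (fun i i' => ?_) fun i i' => ?_
  · simp only [mul_apply, Fintype.sum_prod_type, conjTranspose_apply]
    exact Finset.sum_comm
  · simp only [mul_apply (M := Nᴴ), conjTranspose_apply, transpose_apply, traceOutB]
    rw [Finset.sum_comm]
    simp only [hK, mul_apply, conjTranspose_apply, N, of_apply, mul_comm]
  · simp only [mul_apply (M := Lᴴ), conjTranspose_apply, transpose_apply, traceOutBC]
    rw [Finset.sum_comm, Fintype.sum_prod_type]
    simp only [hK, mul_apply, conjTranspose_apply, L, of_apply, mul_comm]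

end PartialTrace

/-- **Strong subadditivity, conditional form.** For a density matrix `ρ_ABC` on
`ℂ^a ⊗ ℂ^b ⊗ ℂ^c`, the conditional entropies satisfy
`H(ρ_C|ρ_A) + H(ρ_C|ρ_B) ≥ 0`, i.e.
`(H(ρ_AC) - H(ρ_A)) + (H(ρ_BC) - H(ρ_B)) ≥ 0`. -/
theorem vNEntropy_strong_subadditivity_conditional
    (ρ : Matrix (Fin a × Fin b × Fin c) (Fin a × Fin b × Fin c) ℂ)
    (hρ : ρ.PosSemidef) (hρtr : ρ.trace = 1) :
    0 ≤ (vNEntropy (traceOutB ρ) - vNEntropy (traceOutBC ρ)) +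
        (vNEntropy (traceOutA ρ) - vNEntropy (traceOutAC ρ)) := by
  have hne : Nonempty (Fin a × Fin b × Fin c) := by
    by_contra h
    rw [not_nonempty_iff] at h
    simp [trace] at hρtr
  obtain ⟨i, j, k⟩ := hne
  have hb : (0 : ℝ) < b := Nat.cast_pos.mpr j.pos
  have hc : (0 : ℝ) < c := Nat.cast_pos.mpr k.pos
  have hpos {n : Type} [Fintype n] [DecidableEq n] {M : Matrix n n ℂ} (hM : M.PosSemidef)
      {x : ℝ} (hx : 0 < x) : (M + (x : ℂ) • 1).PosDef :=
    PosDef.posSemidef_add hM (PosDef.one.smul (Complex.zero_lt_real.mpr hx))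
  have hlim := ((tendsto_vNEntropy_add_smul_one (traceOutB_posSemidef hρ).1 b).add
      (tendsto_vNEntropy_add_smul_one (traceOutA_posSemidef hρ).1 a)).sub
    ((tendsto_vNEntropy_add_smul_one (traceOutAC_posSemidef hρ).1 (a * c)).add
      (tendsto_vNEntropy_add_smul_one (traceOutBC_posSemidef hρ).1 (b * c)))
  have : 0 ≤ vNEntropy (traceOutB ρ) + vNEntropy (traceOutA ρ) -
      (vNEntropy (traceOutAC ρ) + vNEntropy (traceOutBC ρ)) := by
    refine ge_of_tendsto hlim ?_
    filter_upwards [self_mem_nhdsWithin] with ε hε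
    have hε' : (0 : ℝ) < ε := hε
    rw [← traceOutA_add_smul_one, ← traceOutB_add_smul_one, ← traceOutAC_add_smul_one,
      ← traceOutBC_add_smul_one, sub_nonneg]
    refine vNEntropy_conditional_of_posDef (hpos hρ hε').posSemidef ?_ ?_
    · rw [traceOutB_add_smul_one]
      exact hpos (traceOutB_posSemidef hρ) (mul_pos hε' hb)
    · rw [traceOutBC_add_smul_one]
      exact hpos (traceOutBC_posSemidef hρ) (mul_pos hε' (mul_pos hb hc))
  linarith
end

section
/- (Shannon's noiseless coding theorem, achievability direction / asymptotic equipartition.) Let p be a probability distribution on a finite alphabet X = {1, …, d} and let H(p) = −∑_{i=1}^d p_i log₂ p_i be its Shannon entropy. For every R > H(p) and every ε > 0, for all sufficiently large n there exists a subset S ⊆ X^n with cardinality |S| ≤ 2^{nR} whose probability under the n-fold product (i.i.d.) distribution satisfies p^{⊗n}(S) ≥ 1 − ε. -/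
open Filter Topology in
/-- A function with negative derivative at `0` takes a value below `g 0` at some positive point. -/
theorem HasDerivAt.exists_pos_lt_of_deriv_neg {g : ℝ → ℝ} {g' : ℝ} (hg : HasDerivAt g g' 0)
    (hg' : g' < 0) : ∃ t > 0, g t < g 0 := by
  obtain ⟨t, hslope, ht⟩ :=
    ((hg.tendsto_slope_zero_right.eventually (gt_mem_nhds hg')).and self_mem_nhdsWithin).exists
  have ht : 0 < t := ht
  refine ⟨t, ht, ?_⟩
  simp only [zero_add, smul_eq_mul] at hslope
  by_contra! h
  exact absurd hslope (not_lt.2 (mul_nonneg (inv_nonneg.2 ht.le) (sub_nonneg.2 h)))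

/-- If the mean of `log (p i)` exceeds `-c`, some tilting parameter `t > 0` makes the exponential
moment `∑ i, p i * exp (-t (log (p i) + c))` smaller than `1`. -/
theorem exists_exponential_moment_lt_one {α : Type*} [Fintype α] {p : α → ℝ}
    (hp1 : ∑ i, p i = 1) {c : ℝ} (hc : -∑ i, p i * Real.log (p i) < c) :
    ∃ t > 0, ∑ i, p i * Real.exp (-t * (Real.log (p i) + c)) < 1 := by
  have hderiv : HasDerivAt (fun t : ℝ ↦ ∑ i, p i * Real.exp (-t * (Real.log (p i) + c)))
      (∑ i, p i * (-(Real.log (p i) + c))) 0 := by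
    refine HasDerivAt.fun_sum fun i _ ↦ ?_
    simpa using (((hasDerivAt_id (0 : ℝ)).neg.mul_const (Real.log (p i) + c)).exp).const_mul (p i)
  have hneg : ∑ i, p i * (-(Real.log (p i) + c)) < 0 := by
    simp only [mul_neg, mul_add, Finset.sum_neg_distrib, Finset.sum_add_distrib,
      ← Finset.sum_mul, hp1]
    linarith
  obtain ⟨t, ht, h⟩ := hderiv.exists_pos_lt_of_deriv_neg hneg
  exact ⟨t, ht, by simpa [hp1] using h⟩

/-- Chernoff's pointwise bound for strings whose probability is at most `exp (-n c)`. -/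
theorem prod_le_prod_mul_exp_of_prod_le {n : ℕ} {q : Fin n → ℝ} (hq : ∀ i, 0 ≤ q i) {c t : ℝ}
    (ht : 0 ≤ t) (h : ∏ i, q i ≤ Real.exp (-(n * c))) :
    ∏ i, q i ≤ ∏ i, q i * Real.exp (-t * (Real.log (q i) + c)) := by
  rw [Finset.prod_mul_distrib, ← Real.exp_sum]
  rcases (Finset.prod_nonneg fun i _ ↦ hq i : 0 ≤ ∏ i, q i).eq_or_lt with h0 | hpos
  · simp [← h0]
  refine le_mul_of_one_le_right hpos.le (Real.one_le_exp ?_)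
  have hlog : ∑ i, Real.log (q i) ≤ -(n * c) := by
    rw [← Real.log_prod fun i hi ↦ Finset.prod_ne_zero_iff.1 hpos.ne' i hi]
    exact (Real.log_le_iff_le_exp hpos).2 h
  rw [← Finset.mul_sum, Finset.sum_add_distrib]
  simp only [Finset.sum_const, Finset.card_univ, Fintype.card_fin, nsmul_eq_mul]
  nlinarith


/-- **Shannon's noiseless coding theorem (achievability / AEP).**
Let `p` be a probability distribution on the alphabet `{1,…,d}` with Shannon entropy
`H(p) = -∑ᵢ pᵢ log₂ pᵢ`.  For every rate `R > H(p)` and every `ε > 0`, for all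
sufficiently large `n` there is a set `S` of strings of length `n` with
`|S| ≤ 2^{nR}` and `p^{⊗n}(S) ≥ 1 - ε`. -/
theorem shannon_source_coding_achievability {d : ℕ} (p : Fin d → ℝ)
    (hp0 : ∀ i, 0 ≤ p i) (hp1 : ∑ i, p i = 1)
    (R : ℝ) (hR : (-∑ i, p i * Real.logb 2 (p i)) < R) (ε : ℝ) (hε : 0 < ε) :
    ∃ N : ℕ, ∀ n ≥ N, ∃ S : Finset (Fin n → Fin d),
      (S.card : ℝ) ≤ 2 ^ ((n : ℝ) * R) ∧
      1 - ε ≤ ∑ x ∈ S, ∏ i, p (x i) := by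
  have hlog2 : 0 < Real.log 2 := Real.log_pos one_lt_two
  have hc : -∑ i, p i * Real.log (p i) < R * Real.log 2 := by
    have h := mul_lt_mul_of_pos_right hR hlog2
    rw [neg_mul, Finset.sum_mul] at h
    simpa [Real.logb, mul_assoc, div_mul_cancel₀ _ hlog2.ne'] using h
  obtain ⟨t, ht, hlt⟩ := exists_exponential_moment_lt_one hp1 hc
  set r := ∑ i, p i * Real.exp (-t * (Real.log (p i) + R * Real.log 2)) with hr
  have hr0 : 0 ≤ r := Finset.sum_nonneg fun i _ ↦ mul_nonneg (hp0 i) (Real.exp_pos _).le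
  obtain ⟨N, hN⟩ := exists_pow_lt_of_lt_one hε hlt
  refine ⟨N, fun n hn ↦ ?_⟩
  have hnonneg (x : Fin n → Fin d) : 0 ≤ ∏ i, p (x i) := Finset.prod_nonneg fun i _ ↦ hp0 _
  have htotal : ∑ x : Fin n → Fin d, ∏ i, p (x i) = 1 := by
    rw [← Fintype.sum_pow, hp1, one_pow]
  have hexp : (2 : ℝ) ^ ((n : ℝ) * R) = Real.exp (n * (R * Real.log 2)) := by
    rw [Real.rpow_def_of_pos two_pos]
    ring_nf
  let S : Finset (Fin n → Fin d) :=
    {x | Real.exp (-(n * (R * Real.log 2))) < ∏ i, p (x i)}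
  refine ⟨S, ?_, ?_⟩
  · have hcard : S.card * Real.exp (-(n * (R * Real.log 2))) ≤ 1 :=
      calc S.card * Real.exp (-(n * (R * Real.log 2)))
        _ = ∑ x ∈ S, Real.exp (-(n * (R * Real.log 2))) := by simp
        _ ≤ ∑ x ∈ S, ∏ i, p (x i) :=
          Finset.sum_le_sum fun x hx ↦ (Finset.mem_filter.1 hx).2.le
        _ ≤ ∑ x : Fin n → Fin d, ∏ i, p (x i) :=
          Finset.sum_le_sum_of_subset_of_nonneg S.subset_univ fun x _ _ ↦ hnonneg x
        _ = 1 := htotal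
    rw [hexp]
    rwa [Real.exp_neg, ← div_eq_mul_inv, div_le_one (Real.exp_pos _)] at hcard
  · have hcompl : ∑ x ∈ Sᶜ, ∏ i, p (x i) ≤ ε :=
      calc ∑ x ∈ Sᶜ, ∏ i, p (x i)
        _ ≤ ∑ x ∈ Sᶜ, ∏ i, p (x i) * Real.exp (-t * (Real.log (p (x i)) + R * Real.log 2)) :=
          Finset.sum_le_sum fun x hx ↦
            prod_le_prod_mul_exp_of_prod_le (fun i ↦ hp0 _) ht.le (by simpa [S] using hx)
        _ ≤ ∑ x : Fin n → Fin d,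
              ∏ i, p (x i) * Real.exp (-t * (Real.log (p (x i)) + R * Real.log 2)) :=
          Finset.sum_le_sum_of_subset_of_nonneg (Finset.subset_univ _) fun x _ _ ↦
            Finset.prod_nonneg fun i _ ↦ mul_nonneg (hp0 _) (Real.exp_pos _).le
        _ = r ^ n := by rw [hr, Fintype.sum_pow]
        _ ≤ r ^ N := pow_le_pow_of_le_one hr0 hlt.le hn
        _ ≤ ε := hN.le
    have hsplit := Finset.sum_add_sum_compl S fun x ↦ ∏ i, p (x i)
    linarith
end

section
/- (Shannon's noiseless coding theorem, converse direction.) Let p be a probability distribution on a finite alphabet X = {1, …, d} and let H(p) = −∑_{i=1}^d p_i log₂ p_i be its Shannon entropy. For every R < H(p) there exists δ > 0 such that for all sufficiently large n, every subset S ⊆ X^n with |S| ≤ 2^{nR} has probability p^{⊗n}(S) ≤ 1 − δ under the n-fold product distribution. -/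
/-- A function with negative derivative at `a` takes a smaller value to the right of `a`. -/
theorem HasDerivAt.exists_gt_lt_of_neg {f : ℝ → ℝ} {f' a : ℝ} (hf : HasDerivAt f f' a)
    (hf' : f' < 0) : ∃ s > a, f s < f a := by
  have hslope := (hasDerivAt_iff_tendsto_slope.1 hf).mono_left
    (nhdsWithin_mono a (t := {a}ᶜ) (s := Set.Ioi a) fun x hx => ne_of_gt hx)
  obtain ⟨s, hs, has⟩ :=
    ((hslope.eventually (gt_mem_nhds hf')).and self_mem_nhdsWithin).exists
  have has : a < s := has
  refine ⟨s, has, ?_⟩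
  rw [slope_def_field, div_neg_iff] at hs
  rcases hs with h | h <;> linarith [h.1, h.2]

/-- The probability of a string is at most `exp (-n c)`, up to the Chernoff weight of the event
that it exceeds `exp (-n c)`. -/
theorem prod_le_exp_neg_add_prod_mul_exp {n d : ℕ} {p : Fin d → ℝ} (hp0 : ∀ i, 0 ≤ p i)
    (c : ℝ) {s : ℝ} (hs : 0 ≤ s) (x : Fin n → Fin d) :
    ∏ i, p (x i) ≤ Real.exp (-(n * c)) +
      ∏ i, (p (x i) * Real.exp (s * (Real.log (p (x i)) + c))) := by
  have hprod : 0 ≤ ∏ i, p (x i) := Finset.prod_nonneg fun i _ => hp0 _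
  rw [Finset.prod_mul_distrib, ← Real.exp_sum, ← Finset.mul_sum]
  by_cases hx : ∀ i, p (x i) ≠ 0
  · set L := ∑ i, (Real.log (p (x i)) + c) with hL
    have hL' : L = ∑ i, Real.log (p (x i)) + n * c := by
      simp [hL, Finset.sum_add_distrib]
    rcases le_total L 0 with h | h
    · have hexp : ∏ i, p (x i) = Real.exp (∑ i, Real.log (p (x i))) := by
        rw [Real.exp_sum]
        exact Finset.prod_congr rfl fun i _ =>
          (Real.exp_log ((hp0 _).lt_of_ne' (hx i))).symm
      have : ∏ i, p (x i) ≤ Real.exp (-(n * c)) := by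
        rw [hexp]
        exact Real.exp_le_exp.2 (by linarith)
      have := mul_nonneg hprod (Real.exp_nonneg (s * L))
      linarith
    · have := le_mul_of_one_le_right hprod (Real.one_le_exp (mul_nonneg hs h))
      linarith [Real.exp_nonneg (-(n * c))]
  · push Not at hx
    obtain ⟨i, hi⟩ := hx
    rw [Finset.prod_eq_zero (Finset.mem_univ i) hi]
    simpa using Real.exp_nonneg _


/-- **Shannon's noiseless coding theorem (converse).**
Let `p` be a probability distribution on `{1,…,d}` with Shannon entropy
`H(p) = -∑ᵢ pᵢ log₂ pᵢ`.  For every rate `R < H(p)` there is a `δ > 0` such that for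
all sufficiently large `n`, every set `S` of strings of length `n` with `|S| ≤ 2^{nR}`
has probability `p^{⊗n}(S) ≤ 1 - δ`. -/
theorem shannon_source_coding_converse {d : ℕ} (p : Fin d → ℝ)
    (hp0 : ∀ i, 0 ≤ p i) (hp1 : ∑ i, p i = 1)
    (R : ℝ) (hR : R < -∑ i, p i * Real.logb 2 (p i)) :
    ∃ δ > (0 : ℝ), ∃ N : ℕ, ∀ n ≥ N, ∀ S : Finset (Fin n → Fin d),
      (S.card : ℝ) ≤ 2 ^ ((n : ℝ) * R) →
      ∑ x ∈ S, ∏ i, p (x i) ≤ 1 - δ := by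
  have hlog2 : 0 < Real.log 2 := Real.log_pos one_lt_two
  obtain ⟨R', hRR', hR'⟩ := exists_between hR
  set c := R' * Real.log 2 with hc
  have hderiv : HasDerivAt (fun s : ℝ => ∑ i, p i * Real.exp (s * (Real.log (p i) + c)))
      (∑ i, p i * (Real.log (p i) + c)) 0 := by
    refine HasDerivAt.fun_sum fun i _ => HasDerivAt.const_mul _ ?_
    simpa using ((hasDerivAt_id (0 : ℝ)).mul_const (Real.log (p i) + c)).exp
  have hneg : ∑ i, p i * (Real.log (p i) + c) < 0 := by
    have hH : (∑ i, p i * Real.logb 2 (p i)) * Real.log 2 = ∑ i, p i * Real.log (p i) := by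
      rw [Finset.sum_mul]
      refine Finset.sum_congr rfl fun i _ => ?_
      rw [Real.logb, mul_assoc, div_mul_cancel₀ _ hlog2.ne']
    simp only [mul_add, Finset.sum_add_distrib]
    rw [← Finset.sum_mul, hp1, ← hH]
    nlinarith
  obtain ⟨s, hs, hlt⟩ := hderiv.exists_gt_lt_of_neg hneg
  simp only [zero_mul, Real.exp_zero, mul_one, hp1] at hlt
  set q := ∑ i, p i * Real.exp (s * (Real.log (p i) + c)) with hq
  have hnonneg : ∀ i, 0 ≤ p i * Real.exp (s * (Real.log (p i) + c)) :=
    fun i => mul_nonneg (hp0 i) (Real.exp_nonneg _)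
  have hq0 : 0 ≤ q := Finset.sum_nonneg fun i _ => hnonneg i
  have hr : Real.exp (R * Real.log 2 - c) < 1 := by
    rw [Real.exp_lt_one_iff, hc]
    nlinarith
  have hlim := (tendsto_pow_atTop_nhds_zero_of_lt_one (Real.exp_nonneg _) hr).add
    (tendsto_pow_atTop_nhds_zero_of_lt_one hq0 hlt)
  rw [add_zero] at hlim
  obtain ⟨N, hN⟩ := Filter.eventually_atTop.1
    (hlim.eventually (gt_mem_nhds (one_half_pos (α := ℝ))))
  refine ⟨1 / 2, one_half_pos, N, fun n hn S hS => ?_⟩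
  calc ∑ x ∈ S, ∏ i, p (x i)
      ≤ ∑ x ∈ S, (Real.exp (-(n * c)) +
          ∏ i, (p (x i) * Real.exp (s * (Real.log (p (x i)) + c)))) :=
        Finset.sum_le_sum fun x _ => prod_le_exp_neg_add_prod_mul_exp hp0 c hs.le x
    _ = S.card * Real.exp (-(n * c)) +
          ∑ x ∈ S, ∏ i, (p (x i) * Real.exp (s * (Real.log (p (x i)) + c))) := by
        rw [Finset.sum_add_distrib, Finset.sum_const, nsmul_eq_mul]
    _ ≤ 2 ^ ((n : ℝ) * R) * Real.exp (-(n * c)) +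
          ∑ x : Fin n → Fin d, ∏ i, (p (x i) * Real.exp (s * (Real.log (p (x i)) + c))) := by
        gcongr
        · exact fun x _ _ => Finset.prod_nonneg fun i _ => hnonneg _
        · exact Finset.subset_univ S
    _ = Real.exp (R * Real.log 2 - c) ^ n + q ^ n := by
        rw [hq, Fintype.sum_pow, Real.rpow_def_of_pos two_pos, ← Real.exp_add, ← Real.exp_nat_mul]
        ring_nf
    _ ≤ 1 - 1 / 2 := by linarith [hN n hn]
end

section
/- (Majorization is compatible with Shannon entropy.) If p and q are probability distributions on {1, …, d} and p ≺ q (p is majorized by q), then H(p) ≥ H(q), where H denotes Shannon entropy. -/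
/-- The nonincreasing rearrangement `x↓` of a vector `x ∈ ℝ^d`:
`x↓ 0 ≥ x↓ 1 ≥ ⋯ ≥ x↓ (d-1)`. -/
noncomputable def sortDesc {d : ℕ} (x : Fin d → ℝ) : Fin d → ℝ :=
  fun i => -(((fun j => -x j) ∘ Tuple.sort fun j => -x j) i)

/-- `x` is majorized by `y`, written `x ≺ y`: all initial partial sums of the
nonincreasing rearrangement of `x` are at most the corresponding partial sums
for `y`, and the total sums agree. -/
def MajorizedBy {d : ℕ} (x y : Fin d → ℝ) : Prop :=
  (∀ k : ℕ, ∑ j ∈ Finset.univ.filter (fun j : Fin d => (j : ℕ) < k), sortDesc x j ≤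
      ∑ j ∈ Finset.univ.filter (fun j : Fin d => (j : ℕ) < k), sortDesc y j) ∧
    ∑ j, x j = ∑ j, y j

open Finset in
/-- Abel summation bound: if all initial partial sums of `u` are nonnegative and `c` is antitone
and bounded below by `C` on the first `m` indices, then `C` times the partial sum of `u` is at most
the partial sum of `c * u`. -/
theorem mul_sum_le_sum_mul_of_antitone {d : ℕ} {c u : Fin d → ℝ} (hc : Antitone c)
    (hu : ∀ k : ℕ, 0 ≤ ∑ j ∈ univ.filter (fun j : Fin d => (j : ℕ) < k), u j) (m : ℕ) :
    ∀ C : ℝ, (∀ j : Fin d, (j : ℕ) < m → C ≤ c j) →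
      C * ∑ j ∈ univ.filter (fun j : Fin d => (j : ℕ) < m), u j ≤
        ∑ j ∈ univ.filter (fun j : Fin d => (j : ℕ) < m), c j * u j := by
  induction m with
  | zero => simp
  | succ m ih =>
    intro C hC
    by_cases hm : m < d
    · have hins : univ.filter (fun j : Fin d => (j : ℕ) < m + 1) =
          insert ⟨m, hm⟩ (univ.filter (fun j : Fin d => (j : ℕ) < m)) := by
        ext j
        simp [Fin.ext_iff]
        omega
      have hnot : (⟨m, hm⟩ : Fin d) ∉ univ.filter (fun j : Fin d => (j : ℕ) < m) := by simp
      have hind := ih (c ⟨m, hm⟩) fun j hj => hc (Fin.le_def.2 hj.le)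
      have hle := mul_le_mul_of_nonneg_right (hC ⟨m, hm⟩ (Nat.lt_succ_self m)) (hu (m + 1))
      rw [hins, sum_insert hnot] at hle ⊢
      rw [sum_insert hnot]
      linarith
    · have heq : univ.filter (fun j : Fin d => (j : ℕ) < m + 1) =
          univ.filter (fun j : Fin d => (j : ℕ) < m) := by
        ext j
        have := j.isLt
        simp
        omega
      rw [heq]
      exact ih C fun j hj => hC j (hj.trans (Nat.lt_succ_self m))

/-- If all initial partial sums of `u` are nonnegative and its total sum vanishes, then its pairing
with an antitone sequence is nonnegative. -/
theorem sum_mul_nonneg_of_antitone {d : ℕ} {c u : Fin d → ℝ} (hc : Antitone c)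
    (hu : ∀ k : ℕ, 0 ≤ ∑ j ∈ Finset.univ.filter (fun j : Fin d => (j : ℕ) < k), u j)
    (hu0 : ∑ j, u j = 0) : 0 ≤ ∑ j, c j * u j := by
  obtain ⟨C, hC⟩ := (Set.finite_range c).bddBelow
  have h := mul_sum_le_sum_mul_of_antitone hc hu d C fun j _ => hC ⟨j, rfl⟩
  simpa [hu0] using h

theorem sortDesc_antitone {d : ℕ} (x : Fin d → ℝ) : Antitone (sortDesc x) :=
  fun _ _ hij => neg_le_neg (Tuple.monotone_sort (fun j => -x j) hij)

theorem sortDesc_apply {d : ℕ} (x : Fin d → ℝ) (i : Fin d) :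
    sortDesc x i = x (Tuple.sort (fun j => -x j) i) := by
  simp [sortDesc]

theorem sum_comp_sortDesc {d : ℕ} (f : ℝ → ℝ) (x : Fin d → ℝ) :
    ∑ i, f (sortDesc x i) = ∑ i, f (x i) := by
  simp only [sortDesc_apply]
  exact Equiv.sum_comp (Tuple.sort fun j => -x j) fun i => f (x i)

/-- The tangent line inequality for `x ↦ x * log x` at a point `a > 0`. -/
theorem mul_log_add_mul_sub_le_mul_log {a b : ℝ} (ha : 0 < a) (hb : 0 ≤ b) :
    a * Real.log a + (Real.log a + 1) * (b - a) ≤ b * Real.log b := by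
  rcases hb.eq_or_lt with rfl | hb
  · simp only [zero_mul]
    linarith
  · have h := mul_le_mul_of_nonneg_left (Real.log_le_sub_one_of_pos (div_pos ha hb)) hb.le
    rw [Real.log_div ha.ne' hb.ne', mul_sub_one, mul_div_cancel₀ a hb.ne'] at h
    linarith

/-- Two nonnegative vectors `a`, `b` with `a` antitone admit a common antitone family of slopes
for supporting lines of `x ↦ x * log x` at the entries of `a`, tested at the entries of `b`. -/
theorem exists_antitone_slopes_mul_log {d : ℕ} {a b : Fin d → ℝ} (ha : Antitone a)
    (ha0 : ∀ i, 0 ≤ a i) (hb0 : ∀ i, 0 ≤ b i) :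
    ∃ c : Fin d → ℝ, Antitone c ∧
      ∀ i, a i * Real.log (a i) + c i * (b i - a i) ≤ b i * Real.log (b i) := by
  obtain ⟨C, hC⟩ :=
    (Set.finite_range fun i => min (Real.log (a i)) (Real.log (b i))).bddBelow
  have hCab (i : Fin d) : C ≤ Real.log (a i) ∧ C ≤ Real.log (b i) := le_min_iff.1 (hC ⟨i, rfl⟩)
  refine ⟨fun i => if 0 < a i then Real.log (a i) + 1 else C, fun i j hij => ?_, fun i => ?_⟩
  · have hle := ha hij
    by_cases hj : 0 < a j
    · have hlog := Real.log_le_log hj hle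
      simpa [hj, hj.trans_le hle] using hlog
    · have := (hCab i).1
      dsimp only
      split_ifs <;> linarith
  · rcases (ha0 i).eq_or_lt with h | h
    · simpa [← h, mul_comm] using mul_le_mul_of_nonneg_right (hCab i).2 (hb0 i)
    · simpa [h] using mul_log_add_mul_sub_le_mul_log h (hb0 i)

/-- **Majorization is compatible with Shannon entropy.** If `p ≺ q` are probability
distributions on `{1,…,d}`, then `H(p) ≥ H(q)`, where
`H(p) = -∑ᵢ pᵢ log pᵢ` (convention `0·log 0 = 0`). -/
theorem shannonEntropy_antitone_of_majorizedBy {d : ℕ} (p q : Fin d → ℝ)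
    (hp0 : ∀ i, 0 ≤ p i) (hp1 : ∑ i, p i = 1)
    (hq0 : ∀ i, 0 ≤ q i) (hq1 : ∑ i, q i = 1)
    (hpq : MajorizedBy p q) :
    -∑ i, q i * Real.log (q i) ≤ -∑ i, p i * Real.log (p i) := by
  have hp (i) : 0 ≤ sortDesc p i := by rw [sortDesc_apply]; exact hp0 _
  have hq (i) : 0 ≤ sortDesc q i := by rw [sortDesc_apply]; exact hq0 _
  obtain ⟨c, hc, hle⟩ := exists_antitone_slopes_mul_log (sortDesc_antitone p) hp hq
  have hsum := Finset.sum_le_sum fun i (_ : i ∈ Finset.univ) => hle i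
  have hnonneg : 0 ≤ ∑ i, c i * (sortDesc q i - sortDesc p i) := by
    refine sum_mul_nonneg_of_antitone hc (fun k => ?_) ?_
    · rw [Finset.sum_sub_distrib]
      exact sub_nonneg.2 (hpq.1 k)
    · rw [Finset.sum_sub_distrib, sum_comp_sortDesc (fun x => x), sum_comp_sortDesc (fun x => x),
        hpq.2, sub_self]
  rw [Finset.sum_add_distrib, sum_comp_sortDesc (fun x => x * Real.log x),
    sum_comp_sortDesc (fun x => x * Real.log x)] at hsum
  linarith
end
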